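/- Let ζ be an extremal number. Then ŵ_{3,3}(ζ) = ŵ_{3,4}(ζ) = √5 and λ̂_{3,3}(ζ) = λ̂_{3,4}(ζ) = 1/(2 + √5). -/

import Mathlib

open Polynomial

/-- Height of an integer polynomial: the maximum absolute value of its coefficients. -/
noncomputable def polyH (P : Polynomial ℤ) : ℝ :=
  (((P.support.sup fun i => (P.coeff i).natAbs) : ℕ) : ℝ)

/-- Evaluation of an integer polynomial at a real number. -/
noncomputable def pev (ζ : ℝ) (P : Polynomial ℤ) : ℝ := Polynomial.aeval ζ P

/-- Set of exponents η such that for arbitrarily large X the system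
    H(P) ≤ X, 0 < |P(ζ)| ≤ X^(−η) has a solution of degree at most n. -/
def wSet (n : ℕ) (ζ : ℝ) : Set ℝ :=
  {η | ∀ X₀ : ℝ, ∃ X : ℝ, X₀ ≤ X ∧ ∃ P : Polynomial ℤ,
    P.natDegree ≤ n ∧ polyH P ≤ X ∧ 0 < |pev ζ P| ∧ |pev ζ P| ≤ X ^ (-η)}

/-- The exponent w_n(ζ). -/
noncomputable def wExp (n : ℕ) (ζ : ℝ) : ℝ := sSup (wSet n ζ)

/-- Set of exponents η such that for all sufficiently large X the system
    H(P) ≤ X, 0 < |P(ζ)| ≤ X^(−η) has a solution of degree at most n. -/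
def whSet (n : ℕ) (ζ : ℝ) : Set ℝ :=
  {η | ∃ X₀ : ℝ, ∀ X : ℝ, X₀ ≤ X → ∃ P : Polynomial ℤ,
    P.natDegree ≤ n ∧ polyH P ≤ X ∧ 0 < |pev ζ P| ∧ |pev ζ P| ≤ X ^ (-η)}

/-- The uniform exponent ŵ_n(ζ). -/
noncomputable def whExp (n : ℕ) (ζ : ℝ) : ℝ := sSup (whSet n ζ)

/-- Set of exponents η such that for arbitrarily large X the system
    |x| ≤ X, max_{1≤i≤n} |ζ^i x − y_i| ≤ X^(−η) has a nonzero integer solution. -/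
def lamSet (n : ℕ) (ζ : ℝ) : Set ℝ :=
  {η | ∀ X₀ : ℝ, ∃ X : ℝ, X₀ ≤ X ∧ ∃ x : ℤ, ∃ y : Fin n → ℤ,
    (x ≠ 0 ∨ y ≠ 0) ∧ ((|x| : ℤ) : ℝ) ≤ X ∧
    ∀ i : Fin n, |ζ ^ ((i : ℕ) + 1) * (x : ℝ) - (y i : ℝ)| ≤ X ^ (-η)}

/-- The exponent λ_n(ζ). -/
noncomputable def lamExp (n : ℕ) (ζ : ℝ) : ℝ := sSup (lamSet n ζ)

/-- Set of exponents η such that for all sufficiently large X the system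
    |x| ≤ X, max_{1≤i≤n} |ζ^i x − y_i| ≤ X^(−η) has a nonzero integer solution. -/
def lamhSet (n : ℕ) (ζ : ℝ) : Set ℝ :=
  {η | ∃ X₀ : ℝ, ∀ X : ℝ, X₀ ≤ X → ∃ x : ℤ, ∃ y : Fin n → ℤ,
    (x ≠ 0 ∨ y ≠ 0) ∧ ((|x| : ℤ) : ℝ) ≤ X ∧
    ∀ i : Fin n, |ζ ^ ((i : ℕ) + 1) * (x : ℝ) - (y i : ℝ)| ≤ X ^ (-η)}

/-- The uniform exponent λ̂_n(ζ). -/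
noncomputable def lamhExp (n : ℕ) (ζ : ℝ) : ℝ := sSup (lamhSet n ζ)

/-- Set of exponents η such that for arbitrarily large X the polynomial system has
    at least j linearly independent solutions of degree at most n. -/
def wSetJ (n j : ℕ) (ζ : ℝ) : Set ℝ :=
  {η | ∀ X₀ : ℝ, ∃ X : ℝ, X₀ ≤ X ∧ ∃ P : Fin j → Polynomial ℤ,
    LinearIndependent ℤ P ∧ ∀ i : Fin j,
      (P i).natDegree ≤ n ∧ polyH (P i) ≤ X ∧ 0 < |pev ζ (P i)| ∧ |pev ζ (P i)| ≤ X ^ (-η)}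

/-- The exponent w_{n,j}(ζ). -/
noncomputable def wExpJ (n j : ℕ) (ζ : ℝ) : ℝ := sSup (wSetJ n j ζ)

/-- Set of exponents η such that for all sufficiently large X the polynomial system has
    at least j linearly independent solutions of degree at most n. -/
def whSetJ (n j : ℕ) (ζ : ℝ) : Set ℝ :=
  {η | ∃ X₀ : ℝ, ∀ X : ℝ, X₀ ≤ X → ∃ P : Fin j → Polynomial ℤ,
    LinearIndependent ℤ P ∧ ∀ i : Fin j,
      (P i).natDegree ≤ n ∧ polyH (P i) ≤ X ∧ 0 < |pev ζ (P i)| ∧ |pev ζ (P i)| ≤ X ^ (-η)}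

/-- The uniform exponent ŵ_{n,j}(ζ). -/
noncomputable def whExpJ (n j : ℕ) (ζ : ℝ) : ℝ := sSup (whSetJ n j ζ)

/-- Set of exponents η such that for arbitrarily large X the simultaneous approximation
    system has at least j linearly independent integer vector solutions. -/
def lamSetJ (n j : ℕ) (ζ : ℝ) : Set ℝ :=
  {η | ∀ X₀ : ℝ, ∃ X : ℝ, X₀ ≤ X ∧ ∃ v : Fin j → (Fin (n + 1) → ℤ),
    LinearIndependent ℤ v ∧ ∀ i : Fin j,
      ((|v i 0| : ℤ) : ℝ) ≤ X ∧
      ∀ t : Fin n, |ζ ^ ((t : ℕ) + 1) * ((v i 0 : ℤ) : ℝ) - ((v i t.succ : ℤ) : ℝ)| ≤ X ^ (-η)}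

/-- The exponent λ_{n,j}(ζ). -/
noncomputable def lamExpJ (n j : ℕ) (ζ : ℝ) : ℝ := sSup (lamSetJ n j ζ)

/-- Set of exponents η such that for all sufficiently large X the simultaneous approximation
    system has at least j linearly independent integer vector solutions. -/
def lamhSetJ (n j : ℕ) (ζ : ℝ) : Set ℝ :=
  {η | ∃ X₀ : ℝ, ∀ X : ℝ, X₀ ≤ X → ∃ v : Fin j → (Fin (n + 1) → ℤ),
    LinearIndependent ℤ v ∧ ∀ i : Fin j,
      ((|v i 0| : ℤ) : ℝ) ≤ X ∧
      ∀ t : Fin n, |ζ ^ ((t : ℕ) + 1) * ((v i 0 : ℤ) : ℝ) - ((v i t.succ : ℤ) : ℝ)| ≤ X ^ (-η)}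

/-- The uniform exponent λ̂_{n,j}(ζ). -/
noncomputable def lamhExpJ (n j : ℕ) (ζ : ℝ) : ℝ := sSup (lamhSetJ n j ζ)

/-- An extremal number: a real transcendental number with ŵ₂(ζ) = (3+√5)/2. -/
def IsExtremal (ζ : ℝ) : Prop :=
  Transcendental ℚ ζ ∧ whExp 2 ζ = (3 + Real.sqrt 5) / 2

open Matrix

/-- Value at `ζ` of the polynomial of degree at most two with coefficient vector `p`. -/
noncomputable def quadEval (ζ : ℝ) (p : Fin 3 → ℤ) : ℝ := p 0 + p 1 * ζ + p 2 * ζ ^ 2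

/-- Height of an integer vector of length three. -/
def height3 (p : Fin 3 → ℤ) : ℕ := Finset.univ.sup fun i => (p i).natAbs

/-- The discriminant-like quadratic form that turns `p ⨯₃ q` into the resultant of `p`, `q`. -/
def symDet {R : Type*} [CommRing R] (w : Fin 3 → R) : R := w 0 * w 2 - w 1 ^ 2

theorem height3_le {p : Fin 3 → ℤ} {N : ℕ} : height3 p ≤ N ↔ ∀ i, |p i| ≤ (N : ℤ) := by
  simp only [height3, Finset.sup_le_iff, Finset.mem_univ, true_implies]
  refine forall_congr' fun i => ?_
  rw [Int.abs_eq_natAbs]; exact Nat.cast_le.symm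

theorem abs_le_height3 (p : Fin 3 → ℤ) (i : Fin 3) : |(p i : ℝ)| ≤ height3 p := by
  have := (height3_le (p := p)).1 le_rfl i
  exact_mod_cast this

theorem height3_pos {p : Fin 3 → ℤ} (hp : p ≠ 0) : 1 ≤ height3 p := by
  by_contra! h
  apply hp
  have := (height3_le (p := p) (N := 0)).1 (by omega)
  funext i
  simpa using this i

theorem exists_height3_eq (p : Fin 3 → ℤ) : ∃ i, |p i| = (height3 p : ℤ) := by
  obtain ⟨i, -, hi⟩ := Finset.exists_mem_eq_sup (Finset.univ : Finset (Fin 3))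
    Finset.univ_nonempty (fun i => (p i).natAbs)
  exact ⟨i, by rw [Int.abs_eq_natAbs, height3, hi]⟩

theorem height3_zsmul (a : ℤ) (p : Fin 3 → ℤ) : height3 (a • p) = a.natAbs * height3 p := by
  have h : ∀ i, ((a • p) i).natAbs = a.natAbs * (p i).natAbs := fun i => by
    simp [Int.natAbs_mul]
  apply le_antisymm
  · refine Finset.sup_le fun i _ => ?_
    rw [h]
    exact Nat.mul_le_mul_left _ (Finset.le_sup (f := fun i => (p i).natAbs) (Finset.mem_univ i))
  · obtain ⟨i, hi⟩ := exists_height3_eq p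
    have : (p i).natAbs = height3 p := by
      rw [Int.abs_eq_natAbs] at hi; exact_mod_cast hi
    rw [← this, ← h]
    exact Finset.le_sup (f := fun i => ((a • p) i).natAbs) (Finset.mem_univ i)

theorem quadEval_zsmul (ζ : ℝ) (a : ℤ) (p : Fin 3 → ℤ) :
    quadEval ζ (a • p) = a * quadEval ζ p := by
  simp [quadEval]; ring

theorem quadEval_sub (ζ : ℝ) (p q : Fin 3 → ℤ) :
    quadEval ζ (p - q) = quadEval ζ p - quadEval ζ q := by
  simp [quadEval]; ring

theorem quadEval_add (ζ : ℝ) (p q : Fin 3 → ℤ) :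
    quadEval ζ (p + q) = quadEval ζ p + quadEval ζ q := by
  simp [quadEval]; ring

/-- Vectors with vanishing cross product are proportional. -/
theorem smul_eq_smul_of_cross_eq_zero {u v : Fin 3 → ℤ} (h : u ⨯₃ v = 0) (i : Fin 3) :
    u i • v = v i • u := by
  have h0 := congrFun h 0
  have h1 := congrFun h 1
  have h2 := congrFun h 2
  simp [cross_apply] at h0 h1 h2
  funext j
  fin_cases i <;> fin_cases j <;> simp <;> linarith

/-- If `u` and `v` are orthogonal to `w`, then `w` is proportional to `u ⨯₃ v`. -/
theorem cross_cross_eq_zero {u v w : Fin 3 → ℤ} (hu : u ⬝ᵥ w = 0) (hv : v ⬝ᵥ w = 0) :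
    (u ⨯₃ v) ⨯₃ w = 0 := by
  simp [dotProduct, Fin.sum_univ_three] at hu hv
  funext j
  fin_cases j <;> simp [cross_apply]
  · linear_combination v 0 * hu - u 0 * hv
  · linear_combination v 1 * hu - u 1 * hv
  · linear_combination v 2 * hu - u 2 * hv

theorem exists_ne_zero_of_ne_zero {u : Fin 3 → ℤ} (h : u ≠ 0) : ∃ i, u i ≠ 0 := by
  by_contra! h'
  exact h (funext h')

theorem cross_ne_zero_of_height_lt {ζ : ℝ} (hζ : ∀ p : Fin 3 → ℤ, p ≠ 0 → quadEval ζ p ≠ 0)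
    {u v : Fin 3 → ℤ} (hu : u ≠ 0) (hv : v ≠ 0) (hh : height3 u < height3 v)
    (he : |quadEval ζ v| ≤ |quadEval ζ u|) : u ⨯₃ v ≠ 0 := by
  intro h
  obtain ⟨i, hi⟩ := exists_ne_zero_of_ne_zero hu
  have h1 := smul_eq_smul_of_cross_eq_zero h i
  have h2 := congrArg height3 h1
  rw [height3_zsmul, height3_zsmul] at h2
  have h3 := congrArg (fun p => |quadEval ζ p|) h1
  simp only [quadEval_zsmul, abs_mul] at h3
  have hpos : 0 < |quadEval ζ v| := abs_pos.2 (hζ v hv)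
  have ha : 0 < (u i).natAbs := Int.natAbs_pos.2 hi
  have hlt : (u i).natAbs < (v i).natAbs := by
    by_contra! hle
    have : (v i).natAbs * height3 u < (u i).natAbs * height3 v := by
      calc _ ≤ (u i).natAbs * height3 u := Nat.mul_le_mul_right _ hle
        _ < _ := Nat.mul_lt_mul_of_pos_left hh ha
    omega
  have hlt' : |(u i : ℝ)| < |(v i : ℝ)| := by
    have : |u i| < |v i| := by
      rw [Int.abs_eq_natAbs, Int.abs_eq_natAbs]; exact_mod_cast hlt
    exact_mod_cast this
  have : |(u i : ℝ)| * |quadEval ζ v| < |(v i : ℝ)| * |quadEval ζ u| := by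
    calc _ < |(v i : ℝ)| * |quadEval ζ v| := by gcongr
      _ ≤ _ := by gcongr
  linarith

/-- A sequence of nonzero integer vectors such that the `N`-th one minimises the value at `ζ` among
the vectors of height at most `N`. -/
structure IsMinSeq (ζ : ℝ) (f : ℕ → Fin 3 → ℤ) : Prop where
  ne_zero : ∀ N, f N ≠ 0
  height_le : ∀ N, 1 ≤ N → height3 (f N) ≤ N
  min : ∀ N, 1 ≤ N → ∀ q, q ≠ 0 → height3 q ≤ N → |quadEval ζ (f N)| ≤ |quadEval ζ q|

theorem exists_isMinSeq (ζ : ℝ) : ∃ f, IsMinSeq ζ f := by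
  have key : ∀ N : ℕ, ∃ p : Fin 3 → ℤ, p ≠ 0 ∧ (1 ≤ N → height3 p ≤ N) ∧
      (1 ≤ N → ∀ q, q ≠ 0 → height3 q ≤ N → |quadEval ζ p| ≤ |quadEval ζ q|) := by
    intro N
    rcases Nat.eq_zero_or_pos N with rfl | hN
    · exact ⟨fun _ => 1, fun h => by simpa using congrFun h 0, by simp, by simp⟩
    have hfin : Set.Finite {p : Fin 3 → ℤ | p ≠ 0 ∧ height3 p ≤ N} := by
      refine (Set.finite_Icc (fun _ : Fin 3 => -(N : ℤ)) (fun _ => (N : ℤ))).subset ?_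
      rintro p ⟨-, hp⟩
      rw [height3_le] at hp
      exact ⟨fun i => (abs_le.1 (hp i)).1, fun i => (abs_le.1 (hp i)).2⟩
    have hne : Set.Nonempty {p : Fin 3 → ℤ | p ≠ 0 ∧ height3 p ≤ N} := by
      refine ⟨fun _ => 1, fun h => by simpa using congrFun h 0, ?_⟩
      rw [height3_le]; intro i; simp only [abs_one]; exact_mod_cast hN
    obtain ⟨p, hp, hmin⟩ := Set.exists_min_image _ (fun p => |quadEval ζ p|) hfin hne
    exact ⟨p, hp.1, fun _ => hp.2, fun _ q h1 h2 => hmin q ⟨h1, h2⟩⟩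
  choose f hf using key
  exact ⟨f, fun N => (hf N).1, fun N => (hf N).2.1, fun N => (hf N).2.2⟩

namespace IsMinSeq

variable {ζ : ℝ} {f : ℕ → Fin 3 → ℤ}

theorem anti (hf : IsMinSeq ζ f) {M N : ℕ} (hM : 1 ≤ M) (h : M ≤ N) :
    |quadEval ζ (f N)| ≤ |quadEval ζ (f M)| :=
  hf.min N (hM.trans h) _ (hf.ne_zero M) ((hf.height_le M hM).trans h)

theorem height_gt (hf : IsMinSeq ζ f) {N K : ℕ} (hN : 1 ≤ N)
    (hdrop : |quadEval ζ (f (N + 1))| < |quadEval ζ (f N)|) (hK : N + 1 ≤ K) :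
    N + 1 ≤ height3 (f K) := by
  by_contra! h
  have h1 := hf.min N hN (f K) (hf.ne_zero K) (by omega)
  have h2 := hf.anti (by omega : 1 ≤ N + 1) hK
  linarith

theorem cross_pred_ne_zero (hζ : ∀ p : Fin 3 → ℤ, p ≠ 0 → quadEval ζ p ≠ 0)
    (hf : IsMinSeq ζ f) {K : ℕ} (hK : 2 ≤ height3 (f K)) (hK1 : 1 ≤ K) :
    f (height3 (f K) - 1) ⨯₃ f K ≠ 0 := by
  have h0 := hf.height_le K hK1
  have h1 := hf.height_le (height3 (f K) - 1) (by omega)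
  exact cross_ne_zero_of_height_lt hζ (hf.ne_zero _) (hf.ne_zero _) (by omega)
    (hf.anti (by omega) (by omega))

/-- The indices at which three consecutive minimal vectors are linearly independent. -/
def IsBreak (f : ℕ → Fin 3 → ℤ) (N : ℕ) : Prop :=
  f (N + 1) ⬝ᵥ (f (height3 (f N) - 1) ⨯₃ f N) ≠ 0

theorem IsBreak.drop (hζ : ∀ p : Fin 3 → ℤ, p ≠ 0 → quadEval ζ p ≠ 0)
    (hf : IsMinSeq ζ f) {N : ℕ} (hN : 1 ≤ N) (hb : IsBreak f N) :
    |quadEval ζ (f (N + 1))| < |quadEval ζ (f N)| := by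
  refine lt_of_le_of_ne (hf.anti hN (by omega)) fun h => hb ?_
  have key : f (N + 1) = f N ∨ f (N + 1) = - f N := by
    rcases abs_eq_abs.1 h with h | h
    · left
      by_contra hne
      exact hζ _ (sub_ne_zero.2 hne) (by rw [quadEval_sub, h, sub_self])
    · right
      by_contra hne
      refine hζ (f (N + 1) + f N) (fun h0 => hne (eq_neg_of_add_eq_zero_left h0)) ?_
      rw [quadEval_add, h, neg_add_cancel]
  rcases key with h | h <;> rw [h] <;> simp [dotProduct, Fin.sum_univ_three, cross_apply] <;> ring

theorem dot_eq_zero (hζ : ∀ p : Fin 3 → ℤ, p ≠ 0 → quadEval ζ p ≠ 0)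
    (hf : IsMinSeq ζ f) {N : ℕ} (hN : 1 ≤ N)
    (hdrop : |quadEval ζ (f (N + 1))| < |quadEval ζ (f N)|) {M : ℕ}
    (hM : ∀ K, N < K → K < M → ¬ IsBreak f K) (K : ℕ) (hNK : N ≤ K) (hKM : K ≤ M) :
    f K ⬝ᵥ (f N ⨯₃ f (N + 1)) = 0 := by
  induction K using Nat.strong_induction_on with
  | _ K ih =>
    rcases Nat.lt_or_ge K (N + 2) with hlt | hge
    · have : K = N ∨ K = N + 1 := by omega
      rcases this with rfl | rfl
      · exact dot_self_cross _ _
      · exact dot_cross_self _ _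
    · obtain ⟨J, rfl⟩ : ∃ J, K = J + 1 := ⟨K - 1, by omega⟩
      have hnb := hM J (by omega) (by omega)
      have hht := hf.height_gt hN hdrop (K := J) (by omega)
      have hht' := hf.height_le J (by omega)
      have h1 := ih J (by omega) (by omega) (by omega)
      have h2 := ih (height3 (f J) - 1) (by omega) (by omega) (by omega)
      have hc := hf.cross_pred_ne_zero hζ (K := J) (by omega) (by omega)
      have hp := cross_cross_eq_zero h2 h1
      obtain ⟨i, hi⟩ := exists_ne_zero_of_ne_zero hc
      have h3 := smul_eq_smul_of_cross_eq_zero hp i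
      have h4 := congrArg (fun w => f (J + 1) ⬝ᵥ w) h3
      simp only [dotProduct_smul] at h4
      have h5 : f (J + 1) ⬝ᵥ (f (height3 (f J) - 1) ⨯₃ f J) = 0 := not_not.1 hnb
      rw [h5, smul_zero, smul_eq_mul] at h4
      exact (mul_eq_zero.1 h4).resolve_left hi

end IsMinSeq

theorem one_le_abs_cast {n : ℤ} (h : n ≠ 0) : (1 : ℝ) ≤ |(n : ℝ)| := by
  exact_mod_cast Int.one_le_abs h

theorem abs_mul_sub_mul_le {a b c d A B : ℝ} (ha : |a| ≤ A) (hb : |b| ≤ B) (hc : |c| ≤ A)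
    (hd : |d| ≤ B) : |a * b - c * d| ≤ 2 * (A * B) := by
  have h1 : |a * b| ≤ A * B := by
    rw [abs_mul]; exact mul_le_mul ha hb (abs_nonneg _) ((abs_nonneg _).trans ha)
  have h2 : |c * d| ≤ A * B := by
    rw [abs_mul]; exact mul_le_mul hc hd (abs_nonneg _) ((abs_nonneg _).trans hc)
  linarith [abs_sub (a * b) (c * d)]

theorem one_le_of_det_ne_zero {ζ A B C a : ℝ} {p q r : Fin 3 → ℤ} (hdet : r ⬝ᵥ (p ⨯₃ q) ≠ 0)
    (hp : ∀ i, |(p i : ℝ)| ≤ A) (hq : ∀ i, |(q i : ℝ)| ≤ B) (hr : ∀ i, |(r i : ℝ)| ≤ C)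
    (hAB : A ≤ B) (hBC : B ≤ C)
    (hpa : |quadEval ζ p| ≤ a) (hqa : |quadEval ζ q| ≤ a) (hra : |quadEval ζ r| ≤ a) :
    1 ≤ 6 * (B * C * a) := by
  have h1 := one_le_abs_cast hdet
  have h0 : 0 ≤ A := (abs_nonneg _).trans (hp 0)
  have hid : ((r ⬝ᵥ (p ⨯₃ q) : ℤ) : ℝ) = quadEval ζ p * (q 1 * r 2 - q 2 * r 1)
      - quadEval ζ q * (p 1 * r 2 - p 2 * r 1) + quadEval ζ r * (p 1 * q 2 - p 2 * q 1) := by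
    simp [dotProduct, Fin.sum_univ_three, cross_apply, quadEval]; ring
  have ha : 0 ≤ a := (abs_nonneg _).trans hpa
  have b1 : |quadEval ζ p * (q 1 * r 2 - q 2 * r 1)| ≤ a * (2 * (B * C)) := by
    rw [abs_mul]
    exact mul_le_mul hpa (abs_mul_sub_mul_le (hq 1) (hr 2) (hq 2) (hr 1)) (abs_nonneg _) ha
  have b2 : |quadEval ζ q * (p 1 * r 2 - p 2 * r 1)| ≤ a * (2 * (B * C)) := by
    rw [abs_mul]
    refine mul_le_mul hqa ?_ (abs_nonneg _) ha
    exact abs_mul_sub_mul_le ((hp 1).trans hAB) (hr 2) ((hp 2).trans hAB) (hr 1)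
  have b3 : |quadEval ζ r * (p 1 * q 2 - p 2 * q 1)| ≤ a * (2 * (B * C)) := by
    rw [abs_mul]
    refine mul_le_mul hra ?_ (abs_nonneg _) ha
    exact abs_mul_sub_mul_le ((hp 1).trans hAB) ((hq 2).trans hBC) ((hp 2).trans hAB)
      ((hq 1).trans hBC)
  rw [hid] at h1
  have := abs_add_le (quadEval ζ p * (q 1 * r 2 - q 2 * r 1)
      - quadEval ζ q * (p 1 * r 2 - p 2 * r 1)) (quadEval ζ r * (p 1 * q 2 - p 2 * q 1))
  have := abs_sub (quadEval ζ p * (q 1 * r 2 - q 2 * r 1))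
    (quadEval ζ q * (p 1 * r 2 - p 2 * r 1))
  linarith

theorem cross_zero_bound {B C : ℝ} {p q : Fin 3 → ℤ}
    (hp : ∀ i, |(p i : ℝ)| ≤ B) (hq : ∀ i, |(q i : ℝ)| ≤ C) :
    |((p ⨯₃ q) 0 : ℝ)| ≤ 2 * (B * C) := by
  simpa [cross_apply] using abs_mul_sub_mul_le (hp 1) (hq 2) (hp 2) (hq 1)

theorem cross_one_bound {ζ B a : ℝ} {p q : Fin 3 → ℤ}
    (hp : ∀ i, |(p i : ℝ)| ≤ B) (hq : ∀ i, |(q i : ℝ)| ≤ B)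
    (hpa : |quadEval ζ p| ≤ a) (hqa : |quadEval ζ q| ≤ a) :
    |((p ⨯₃ q) 1 : ℝ) - ζ * (p ⨯₃ q) 0| ≤ 2 * (B * a) := by
  have : ((p ⨯₃ q) 1 : ℝ) - ζ * (p ⨯₃ q) 0 = p 2 * quadEval ζ q - q 2 * quadEval ζ p := by
    simp [cross_apply, quadEval]; ring
  rw [this]
  exact abs_mul_sub_mul_le (hp 2) hqa (hq 2) hpa

theorem cross_two_bound {ζ B a : ℝ} {p q : Fin 3 → ℤ}
    (hp : ∀ i, |(p i : ℝ)| ≤ B) (hq : ∀ i, |(q i : ℝ)| ≤ B)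
    (hpa : |quadEval ζ p| ≤ a) (hqa : |quadEval ζ q| ≤ a) :
    |((p ⨯₃ q) 2 : ℝ) - ζ ^ 2 * (p ⨯₃ q) 0| ≤ 2 * (B * a) := by
  have : ((p ⨯₃ q) 2 : ℝ) - ζ ^ 2 * (p ⨯₃ q) 0 = q 1 * quadEval ζ p - p 1 * quadEval ζ q := by
    simp [cross_apply, quadEval]; ring
  rw [this]
  exact abs_mul_sub_mul_le (hq 1) hpa (hp 1) hqa

theorem cross_osc_bound {ζ B a : ℝ} {p q : Fin 3 → ℤ}
    (hp : ∀ i, |(p i : ℝ)| ≤ B) (hq : ∀ i, |(q i : ℝ)| ≤ B)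
    (hpa : |quadEval ζ p| ≤ a) (hqa : |quadEval ζ q| ≤ a) :
    |((p ⨯₃ q) 2 : ℝ) - 2 * ζ * (p ⨯₃ q) 1 + ζ ^ 2 * (p ⨯₃ q) 0|
      ≤ 2 * (B * a) * (1 + 2 * |ζ|) := by
  have h1 := cross_one_bound hp hq hpa hqa
  have h2 := cross_two_bound hp hq hpa hqa
  have : ((p ⨯₃ q) 2 : ℝ) - 2 * ζ * (p ⨯₃ q) 1 + ζ ^ 2 * (p ⨯₃ q) 0
      = (((p ⨯₃ q) 2 : ℝ) - ζ ^ 2 * (p ⨯₃ q) 0)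
        - 2 * ζ * (((p ⨯₃ q) 1 : ℝ) - ζ * (p ⨯₃ q) 0) := by ring
  rw [this]
  refine (abs_sub _ _).trans ?_
  rw [abs_mul, abs_mul, abs_two]
  have := mul_le_mul_of_nonneg_left h1 (by positivity : 0 ≤ 2 * |ζ|)
  linarith

theorem half_le_of_symDet_ne_zero {ζ : ℝ} {w : Fin 3 → ℤ} (hw : symDet w ≠ 0)
    (h1 : |(w 1 : ℝ) - ζ * w 0| ≤ 1 / 2) :
    1 / 2 ≤ |(w 0 : ℝ)| * |(w 2 : ℝ) - 2 * ζ * w 1 + ζ ^ 2 * w 0| := by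
  have h := one_le_abs_cast hw
  have hid : ((symDet w : ℤ) : ℝ) = w 0 * (w 2 - 2 * ζ * w 1 + ζ ^ 2 * w 0)
      - (w 1 - ζ * w 0) ^ 2 := by
    simp [symDet]; ring
  rw [hid] at h
  have h2 := abs_sub ((w 0 : ℝ) * (w 2 - 2 * ζ * w 1 + ζ ^ 2 * w 0)) ((w 1 - ζ * w 0) ^ 2)
  rw [abs_mul, abs_pow] at h2
  have : |(w 1 : ℝ) - ζ * w 0| ^ 2 ≤ (1 / 2) ^ 2 := by gcongr
  linarith

/-- Two proportional vectors close to multiples of `(1, ζ, ζ ^ 2)`. -/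
theorem half_le_of_proportional {ζ : ℝ} {w w' : Fin 3 → ℤ} (hw : symDet w ≠ 0)
    (hw' : symDet w' ≠ 0) (h1 : |(w 1 : ℝ) - ζ * w 0| ≤ 1 / 2)
    (h1' : |(w' 1 : ℝ) - ζ * w' 0| ≤ 1 / 2) (hc : w ⨯₃ w' = 0) :
    1 / 2 ≤ |(w 0 : ℝ)| * |(w' 2 : ℝ) - 2 * ζ * w' 1 + ζ ^ 2 * w' 0| := by
  have a := half_le_of_symDet_ne_zero hw h1
  have a' := half_le_of_symDet_ne_zero hw' h1'
  have hs := smul_eq_smul_of_cross_eq_zero hc 0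
  have e1 : (w 0 : ℝ) * w' 1 = w' 0 * w 1 := by exact_mod_cast congrFun hs 1
  have e2 : (w 0 : ℝ) * w' 2 = w' 0 * w 2 := by exact_mod_cast congrFun hs 2
  have key : |(w 0 : ℝ)| * |(w' 2 : ℝ) - 2 * ζ * w' 1 + ζ ^ 2 * w' 0|
      = |(w' 0 : ℝ)| * |(w 2 : ℝ) - 2 * ζ * w 1 + ζ ^ 2 * w 0| := by
    rw [← abs_mul, ← abs_mul]; congr 1
    linear_combination e2 - 2 * ζ * e1
  by_contra! hlt
  have hlt' := hlt
  rw [key] at hlt'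
  have h3 : 0 ≤ |(w 0 : ℝ)| * |(w' 2 : ℝ) - 2 * ζ * w' 1 + ζ ^ 2 * w' 0| := by positivity
  have := mul_lt_mul'' hlt hlt' h3 (by rw [← key]; exact h3)
  have := mul_le_mul a a' (by norm_num) (by positivity)
  nlinarith

theorem symDet_ne_zero_of_proportional {w w' : Fin 3 → ℤ} (hw : symDet w ≠ 0) (hw' : w' ≠ 0)
    (hc : w ⨯₃ w' = 0) : symDet w' ≠ 0 := by
  intro h
  obtain ⟨i, hi⟩ := exists_ne_zero_of_ne_zero hw'
  have hs := smul_eq_smul_of_cross_eq_zero hc i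
  have e : ∀ j, w i * w' j = w' i * w j := fun j => congrFun hs j
  have : w' i ^ 2 * symDet w = w i ^ 2 * symDet w' := by
    simp only [symDet]
    linear_combination (-w' i * w 2) * e 0 - w i * w' 0 * e 2 + (w i * w' 1 + w' i * w 1) * e 1
  rw [h, mul_zero] at this
  rcases mul_eq_zero.1 this with h | h
  · exact hi (pow_eq_zero_iff two_ne_zero |>.1 h)
  · exact hw h

/-- A nonzero integer vector on the cone `w 0 * w 2 = w 1 ^ 2` with `w 0 ≠ 0`. -/
theorem exists_coprime_of_symDet_eq_zero {w : Fin 3 → ℤ} (hw : symDet w = 0) (h0 : w 0 ≠ 0) :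
    ∃ k s t : ℤ, IsCoprime s t ∧ w 0 = k * s ^ 2 ∧ w 1 = k * (s * t) ∧ w 2 = k * t ^ 2 := by
  obtain ⟨s, t, hst, hs, ht⟩ : ∃ s t : ℤ, IsCoprime s t ∧
      w 0 = (Int.gcd (w 0) (w 1) : ℤ) * s ∧ w 1 = (Int.gcd (w 0) (w 1) : ℤ) * t := by
    have hpos : 0 < Int.gcd (w 0) (w 1) := Int.gcd_pos_of_ne_zero_left _ h0
    refine ⟨w 0 / Int.gcd (w 0) (w 1), w 1 / Int.gcd (w 0) (w 1), ?_, ?_, ?_⟩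
    · rw [Int.isCoprime_iff_gcd_eq_one]; exact Int.gcd_div_gcd_div_gcd hpos
    · exact (Int.mul_ediv_cancel' (Int.gcd_dvd_left ..)).symm
    · exact (Int.mul_ediv_cancel' (Int.gcd_dvd_right ..)).symm
  set d : ℤ := (Int.gcd (w 0) (w 1) : ℤ) with hd
  have hd0 : d ≠ 0 := by
    intro h; rw [h, zero_mul] at hs; exact h0 hs
  have hs0 : s ≠ 0 := by
    intro h; rw [h, mul_zero] at hs; exact h0 hs
  have h1 : s * w 2 = d * t ^ 2 := by
    apply mul_left_cancel₀ hd0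
    have : w 0 * w 2 - w 1 ^ 2 = 0 := hw
    rw [hs, ht] at this
    linear_combination this
  obtain ⟨k, hk⟩ : s ∣ d := (hst.pow_right (n := 2)).dvd_of_dvd_mul_right ⟨w 2, h1.symm⟩
  refine ⟨k, s, t, hst, ?_, ?_, ?_⟩
  · rw [hs, hk]; ring
  · rw [ht, hk]; ring
  · apply mul_left_cancel₀ hs0
    rw [h1, hk]; ring

theorem one_le_of_symDet_eq_zero {ζ A B C a b : ℝ} {p q r : Fin 3 → ℤ}
    (hdet : r ⬝ᵥ (p ⨯₃ q) ≠ 0) (hD : symDet (q ⨯₃ r) = 0)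
    (hp : ∀ i, |(p i : ℝ)| ≤ A) (hq : ∀ i, |(q i : ℝ)| ≤ B) (hr : ∀ i, |(r i : ℝ)| ≤ C)
    (hBC : B ≤ C)
    (hpa : |quadEval ζ p| ≤ a) (hqb : |quadEval ζ q| ≤ b) (hrb : |quadEval ζ r| ≤ b)
    (hsmall : 2 * (C * b) * (1 + 2 * |ζ|) < 1) :
    1 ≤ B ^ 2 * a + A * (2 * (C * b)) * (2 + 2 * |ζ|) := by
  have hqC := fun i => (hq i).trans hBC
  have hα := cross_one_bound hqC hr hqb hrb
  have hκ := cross_osc_bound hqC hr hqb hrb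
  set w := q ⨯₃ r with hw
  set e := 2 * (C * b) with he
  have he0 : 0 ≤ e := (abs_nonneg _).trans hα
  have hB0 : 0 ≤ B := (abs_nonneg _).trans (hq 0)
  have hA0 : 0 ≤ A := (abs_nonneg _).trans (hp 0)
  have hz0 := abs_nonneg ζ
  have he1 : e ≤ 1 := by nlinarith
  have hpw : p ⬝ᵥ w ≠ 0 := by
    rw [hw]; convert hdet using 1
    simp [dotProduct, Fin.sum_univ_three, cross_apply]; ring
  have hqw : q ⬝ᵥ w = 0 := dot_self_cross _ _
  have hw0 : w 0 ≠ 0 := by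
    intro h0
    have h1 : w 1 = 0 := by
      have : w 0 * w 2 - w 1 ^ 2 = 0 := hD
      rw [h0] at this
      exact pow_eq_zero_iff two_ne_zero |>.1 (by linarith)
    have h2 : w 2 = 0 := by
      by_contra h2
      have := one_le_abs_cast h2
      rw [h0, h1] at hκ
      simp at hκ
      linarith
    apply hpw
    simp [dotProduct, Fin.sum_univ_three, h0, h1, h2]
  obtain ⟨k, s, t, hst, e0, e1, e2⟩ := exists_coprime_of_symDet_eq_zero hD hw0
  have hk0 : k ≠ 0 := by rintro rfl; simp at e0; exact hw0 e0
  have hs0 : s ≠ 0 := by rintro rfl; simp at e0; exact hw0 e0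
  simp only [dotProduct, Fin.sum_univ_three, e0, e1, e2] at hpw hqw
  have hq' : q 0 * s ^ 2 + q 1 * (s * t) + q 2 * t ^ 2 = 0 := by
    apply mul_left_cancel₀ hk0; linear_combination hqw
  have hn : p 0 * s ^ 2 + p 1 * (s * t) + p 2 * t ^ 2 ≠ 0 := by
    intro h; apply hpw; linear_combination k * h
  have hsB : |(s : ℝ)| ≤ B := by
    have hle : ∀ i, q i ≠ 0 → s ∣ q i → |(s : ℝ)| ≤ B := by
      intro i hi hd
      have : |s| ≤ |q i| := Int.le_of_dvd (abs_pos.2 hi) ((abs_dvd_abs _ _).2 hd)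
      exact le_trans (by exact_mod_cast this) (hq i)
    by_cases h2 : q 2 = 0
    · by_cases h1 : q 1 = 0
      · exfalso
        rw [h1, h2] at hq'
        have h0 : q 0 = 0 := by
          have : q 0 * s ^ 2 = 0 := by linarith
          exact (mul_eq_zero.1 this).resolve_right (pow_ne_zero _ hs0)
        apply hdet
        simp [dotProduct, Fin.sum_univ_three, cross_apply, h0, h1, h2]
      · refine hle 1 h1 (hst.dvd_of_dvd_mul_right ⟨-q 0, ?_⟩)
        apply mul_left_cancel₀ hs0
        rw [h2] at hq'
        linear_combination hq'
    · refine hle 2 h2 ((hst.pow_right (n := 2)).dvd_of_dvd_mul_right ⟨-q 0 * s - q 1 * t, ?_⟩)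
      linear_combination hq'
  have hks : (1 : ℝ) ≤ |(k : ℝ)| := one_le_abs_cast hk0
  have hs1 : (1 : ℝ) ≤ |(s : ℝ)| := one_le_abs_cast hs0
  have hα' : |(k : ℝ)| * (|(s : ℝ)| * |(t : ℝ) - ζ * s|) ≤ e := by
    rw [← abs_mul, ← abs_mul]
    refine le_trans (le_of_eq ?_) hα
    rw [e0, e1]; push_cast; congr 1; ring
  have hst1 : |(s : ℝ)| * |(t : ℝ) - ζ * s| ≤ e :=
    le_trans (le_mul_of_one_le_left (by positivity) hks) hα'
  have hst2 : |(t : ℝ) - ζ * s| ≤ e :=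
    le_trans (le_mul_of_one_le_left (by positivity) hs1) hst1
  have hone := one_le_abs_cast hn
  have hid : (((p 0 * s ^ 2 + p 1 * (s * t) + p 2 * t ^ 2 : ℤ)) : ℝ)
      = (s : ℝ) ^ 2 * quadEval ζ p + p 1 * (s * (t - ζ * s))
        + p 2 * (2 * ζ * (s * (t - ζ * s)) + (t - ζ * s) * (t - ζ * s)) := by
    push_cast; simp [quadEval]; ring
  rw [hid] at hone
  have b1 : |(s : ℝ) ^ 2 * quadEval ζ p| ≤ B ^ 2 * a := by
    rw [abs_mul, abs_pow]
    gcongr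
  have b2 : |(p 1 : ℝ) * (s * (t - ζ * s))| ≤ A * e := by
    rw [abs_mul, abs_mul]
    exact mul_le_mul (hp 1) hst1 (by positivity) hA0
  have b3 : |2 * ζ * (s * (t - ζ * s)) + ((t : ℝ) - ζ * s) * (t - ζ * s)|
      ≤ 2 * |ζ| * e + e := by
    refine (abs_add_le _ _).trans ?_
    rw [abs_mul, abs_mul, abs_mul, abs_mul, abs_two]
    have : |(t : ℝ) - ζ * s| * |(t : ℝ) - ζ * s| ≤ e * 1 :=
      mul_le_mul hst2 (hst2.trans he1) (abs_nonneg _) he0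
    have := mul_le_mul_of_nonneg_left hst1 (by positivity : 0 ≤ 2 * |ζ|)
    linarith
  have b4 : |(p 2 : ℝ) * (2 * ζ * (s * (t - ζ * s)) + (t - ζ * s) * (t - ζ * s))|
      ≤ A * (2 * |ζ| * e + e) := by
    rw [abs_mul]
    exact mul_le_mul (hp 2) b3 (abs_nonneg _) hA0
  have c1 := abs_add_le ((s : ℝ) ^ 2 * quadEval ζ p + p 1 * (s * (t - ζ * s)))
    (p 2 * (2 * ζ * (s * (t - ζ * s)) + (t - ζ * s) * (t - ζ * s)))
  have c2 := abs_add_le ((s : ℝ) ^ 2 * quadEval ζ p) (p 1 * (s * (t - ζ * s)))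
  linarith

theorem exists_mul_rpow_neg_lt (C : ℝ) {s e : ℝ} (hs : 0 < s) (he : 0 < e) :
    ∃ H : ℕ, 1 ≤ H ∧ ∀ x : ℝ, (H : ℝ) ≤ x → C * x ^ (-s) < e := by
  have h := (tendsto_rpow_neg_atTop hs).const_mul C
  rw [mul_zero] at h
  obtain ⟨a, ha⟩ := Filter.eventually_atTop.1 (h.eventually_lt_const he)
  obtain ⟨n, hn⟩ := exists_nat_ge a
  refine ⟨n + 1, by omega, fun x hx => ha x ?_⟩
  push_cast at hx; linarith

namespace IsMinSeq

variable {ζ : ℝ} {f : ℕ → Fin 3 → ℤ}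

theorem exists_le_height (hζ : ∀ p : Fin 3 → ℤ, p ≠ 0 → quadEval ζ p ≠ 0) (hf : IsMinSeq ζ f)
    {τ : ℝ} (hτ : 0 < τ) {N₀ : ℕ}
    (hs : ∀ N : ℕ, N₀ ≤ N → |quadEval ζ (f N)| ≤ ((N : ℝ) + 1) ^ (-τ)) (H : ℕ) :
    ∃ M, ∀ N, M ≤ N → H ≤ height3 (f N) := by
  obtain ⟨M, hM1, hM⟩ := exists_mul_rpow_neg_lt 1 hτ (abs_pos.2 (hζ _ (hf.ne_zero (H + 1))))
  refine ⟨max M N₀, fun N hN => ?_⟩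
  by_contra! h
  have h1 := hf.min (H + 1) (by omega) (f N) (hf.ne_zero N) (by omega)
  have h2 := hs N (le_of_max_le_right hN)
  have h3 : (M : ℝ) ≤ N := by exact_mod_cast le_of_max_le_left hN
  have h4 := hM ((N : ℝ) + 1) (by linarith)
  linarith

theorem pred_le (hf : IsMinSeq ζ f) {τ : ℝ} {N₀ : ℕ}
    (hs : ∀ N : ℕ, N₀ ≤ N → |quadEval ζ (f N)| ≤ ((N : ℝ) + 1) ^ (-τ)) {K : ℕ}
    (hK : N₀ + 2 ≤ height3 (f K)) (hK1 : 1 ≤ K) :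
    |quadEval ζ (f (height3 (f K) - 1))| ≤ (height3 (f K) : ℝ) ^ (-τ) ∧
    |quadEval ζ (f K)| ≤ (height3 (f K) : ℝ) ^ (-τ) ∧
    ∀ i, |(f (height3 (f K) - 1) i : ℝ)| ≤ height3 (f K) := by
  have h1 := hs (height3 (f K) - 1) (by omega)
  have e : ((height3 (f K) - 1 : ℕ) : ℝ) + 1 = height3 (f K) := by
    have : height3 (f K) - 1 + 1 = height3 (f K) := by omega
    exact_mod_cast this
  rw [e] at h1
  have h2 := hf.height_le K hK1
  have h3 := hf.height_le (height3 (f K) - 1) (by omega)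
  refine ⟨h1, (hf.anti (by omega) (by omega)).trans h1, fun i => ?_⟩
  refine (abs_le_height3 _ i).trans ?_
  exact_mod_cast h3.trans (by omega)

theorem exists_isBreak (hζ : ∀ p : Fin 3 → ℤ, p ≠ 0 → quadEval ζ p ≠ 0) (hf : IsMinSeq ζ f)
    {τ : ℝ} (hτ : 1 < τ) {N₀ : ℕ}
    (hs : ∀ N : ℕ, N₀ ≤ N → |quadEval ζ (f N)| ≤ ((N : ℝ) + 1) ^ (-τ)) (M : ℕ) :
    ∃ N, M ≤ N ∧ IsBreak f N := by
  by_contra! hno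
  obtain ⟨N, hMN, hN1, hdrop⟩ : ∃ N, M ≤ N ∧ 1 ≤ N ∧
      |quadEval ζ (f (N + 1))| < |quadEval ζ (f N)| := by
    by_contra! hcon
    have hconst : ∀ k, |quadEval ζ (f (M + 1))| ≤ |quadEval ζ (f (M + 1 + k))| := by
      intro k
      induction k with
      | zero => simp
      | succ k ih => exact ih.trans (hcon (M + 1 + k) (by omega) (by omega))
    obtain ⟨H, -, hH⟩ := exists_mul_rpow_neg_lt 1 (by linarith : 0 < τ)
      (abs_pos.2 (hζ _ (hf.ne_zero (M + 1))))
    have h1 := hconst (H + N₀)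
    have h2 := hs (M + 1 + (H + N₀)) (by omega)
    have h3 := hH (((M + 1 + (H + N₀) : ℕ) : ℝ) + 1) (by
      have : (0 : ℝ) ≤ M := Nat.cast_nonneg M
      have : (0 : ℝ) ≤ N₀ := Nat.cast_nonneg N₀
      push_cast; linarith)
    linarith
  have hW : f N ⨯₃ f (N + 1) ≠ 0 := by
    refine cross_ne_zero_of_height_lt hζ (hf.ne_zero _) (hf.ne_zero _) ?_ hdrop.le
    have := hf.height_gt hN1 hdrop le_rfl
    have := hf.height_le N hN1
    omega
  obtain ⟨i, hi⟩ := exists_ne_zero_of_ne_zero hW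
  set W := f N ⨯₃ f (N + 1) with hWdef
  set κ : ℝ := (W 2 : ℝ) - 2 * ζ * W 1 + ζ ^ 2 * W 0 with hκ
  have hκ0 : κ ≠ 0 := by
    have := hζ ![W 2, -2 * W 1, W 0] (by
      intro h
      have h0 := congrFun h 0
      have h1 := congrFun h 1
      have h2 := congrFun h 2
      simp at h0 h1 h2
      fin_cases i <;> simp_all)
    intro h
    apply this
    simp [quadEval]
    linarith
  obtain ⟨H, hH1, hH⟩ := exists_mul_rpow_neg_lt (|(W i : ℝ)| * (2 * (1 + 2 * |ζ|)))
    (by linarith : 0 < τ - 1) (abs_pos.2 hκ0)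
  obtain ⟨K₀, hK₀⟩ := hf.exists_le_height hζ (by linarith : 0 < τ) hs (max H (max N (N₀ + 2)) + 2)
  have hK := hK₀ (K₀ + N + 1) (by omega)
  set K := K₀ + N + 1 with hKdef
  obtain ⟨p1, p2, p3⟩ := hf.pred_le hs (K := K) (by omega) (by omega)
  have hhK := hf.height_le K (by omega)
  have hc0 := hf.cross_pred_ne_zero hζ (K := K) (by omega) (by omega)
  have hnb : ∀ J, N < J → J < K → ¬ IsBreak f J := fun J h _ => hno J (by omega)
  have d1 := hf.dot_eq_zero hζ hN1 hdrop hnb K (by omega) le_rfl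
  have d2 := hf.dot_eq_zero hζ hN1 hdrop hnb (height3 (f K) - 1) (by omega) (by omega)
  have hprop := cross_cross_eq_zero d2 d1
  have hκc := cross_osc_bound p3 (abs_le_height3 (f K)) p1 p2
  set c := f (height3 (f K) - 1) ⨯₃ f K with hc
  set h : ℝ := (height3 (f K) : ℝ) with hh
  have hrel : ∀ j, (c i : ℝ) * W j = W i * c j := fun j => by
    exact_mod_cast congrFun (smul_eq_smul_of_cross_eq_zero hprop i) j
  have hci : c i ≠ 0 := by
    intro h0
    obtain ⟨j, hj⟩ := exists_ne_zero_of_ne_zero hc0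
    have := hrel j
    rw [h0] at this
    simp at this
    exact this.elim hi hj
  have hkk : |(c i : ℝ)| * |κ| = |(W i : ℝ)| * |(c 2 : ℝ) - 2 * ζ * c 1 + ζ ^ 2 * c 0| := by
    rw [← abs_mul, ← abs_mul]; congr 1
    linear_combination hrel 2 - 2 * ζ * hrel 1 + ζ ^ 2 * hrel 0
  have hHh : (H : ℝ) ≤ h := by
    rw [hh]; exact_mod_cast (by omega : H ≤ height3 (f K))
  have hpos : 0 < h := lt_of_lt_of_le (by exact_mod_cast hH1) hHh
  have hfin := hH h hHh
  have e : h ^ (-(τ - 1)) = h * h ^ (-τ) := by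
    rw [show -(τ - 1) = 1 + -τ by ring, Real.rpow_add hpos, Real.rpow_one]
  rw [e] at hfin
  have h1 : |κ| ≤ |(c i : ℝ)| * |κ| := le_mul_of_one_le_left (abs_nonneg _) (one_le_abs_cast hci)
  have h2 := mul_le_mul_of_nonneg_left hκc (abs_nonneg (W i : ℝ))
  linarith

theorem IsBreak.facts (hζ : ∀ p : Fin 3 → ℤ, p ≠ 0 → quadEval ζ p ≠ 0) (hf : IsMinSeq ζ f)
    {τ : ℝ} (hτ : 2 < τ) {N₀ : ℕ}
    (hs : ∀ N : ℕ, N₀ ≤ N → |quadEval ζ (f N)| ≤ ((N : ℝ) + 1) ^ (-τ)) :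
    ∃ M, ∀ N, M ≤ N → IsBreak f N → symDet (f N ⨯₃ f (N + 1)) ≠ 0 ∧
      |((f N ⨯₃ f (N + 1)) 1 : ℝ) - ζ * (f N ⨯₃ f (N + 1)) 0| ≤ 1 / 2 ∧
      |((f N ⨯₃ f (N + 1)) 0 : ℝ)| ≤ 2 * (height3 (f N) * ((N : ℝ) + 1)) ∧
      (height3 (f N) : ℝ) ^ (τ - 1) ≤ 6 * ((N : ℝ) + 1) ∧
      ((N : ℝ) + 1) ^ (τ - 2) ≤ 8 * (1 + 2 * |ζ|) * height3 (f N) := by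
  obtain ⟨H, hH1, hH⟩ := exists_mul_rpow_neg_lt (2 * (2 + 2 * |ζ|)) (by linarith : 0 < τ - 2)
    (by norm_num : (0 : ℝ) < 1 / 4)
  obtain ⟨M, hM⟩ := hf.exists_le_height hζ (by linarith : 0 < τ) hs (max H (N₀ + 2))
  refine ⟨max M (N₀ + 2), fun N hN hb => ?_⟩
  have hN1 : 1 ≤ N := by omega
  have hht := hM N (by omega)
  have hhN := hf.height_le N hN1
  obtain ⟨p1, p2, p3⟩ := hf.pred_le hs (K := N) (by omega) hN1
  have hsN := hs N (by omega)
  have hdrop := hb.drop hζ hf hN1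
  have hhr := hf.height_le (N + 1) (by omega)
  set x : ℝ := (height3 (f N) : ℝ) with hx
  set y : ℝ := (N : ℝ) + 1 with hy
  have hxy : x ≤ y := by
    have : x ≤ N := by rw [hx]; exact_mod_cast hhN
    linarith
  have hHx : (H : ℝ) ≤ x := by rw [hx]; exact_mod_cast (by omega : H ≤ height3 (f N))
  have hx1 : 1 ≤ x := le_trans (by exact_mod_cast hH1) hHx
  have hx0 : 0 < x := by linarith
  have hy0 : 0 < y := by linarith
  have hz := abs_nonneg ζ
  have hr : ∀ i, |(f (N + 1) i : ℝ)| ≤ y := fun i =>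
    (abs_le_height3 _ i).trans (by rw [hy]; exact_mod_cast hhr)
  have hq : ∀ i, |(f N i : ℝ)| ≤ x := abs_le_height3 _
  have hq' : ∀ i, |(f N i : ℝ)| ≤ y := fun i => (hq i).trans hxy
  have hrs := hdrop.le.trans hsN
  have fx := hH x hHx
  have fy := hH y (hHx.trans hxy)
  have ex : x ^ (-(τ - 2)) = x ^ 2 * x ^ (-τ) := by
    rw [show -(τ - 2) = 2 + -τ by ring, Real.rpow_add hx0, Real.rpow_two]
  have ey : y ^ (-(τ - 2)) = y ^ 2 * y ^ (-τ) := by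
    rw [show -(τ - 2) = 2 + -τ by ring, Real.rpow_add hy0, Real.rpow_two]
  rw [ex] at fx
  rw [ey] at fy
  have hyt : 0 < y ^ (-τ) := Real.rpow_pos_of_pos hy0 _
  have hxt : 0 < x ^ (-τ) := Real.rpow_pos_of_pos hx0 _
  have hyy : y * y ^ (-τ) ≤ y ^ 2 * y ^ (-τ) := by
    gcongr; nlinarith
  have hpos2 : 0 ≤ y ^ 2 * y ^ (-τ) := by positivity
  have hpos2x : 0 ≤ x ^ 2 * x ^ (-τ) := by positivity
  have hzy := mul_nonneg hz hpos2
  have hzx := mul_nonneg hz hpos2x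
  have hzyy := mul_le_mul_of_nonneg_left hyy hz
  have hα := cross_one_bound hq' hr hsN hrs
  have hα' : |((f N ⨯₃ f (N + 1)) 1 : ℝ) - ζ * (f N ⨯₃ f (N + 1)) 0| ≤ 1 / 2 := by
    linarith
  have hD : symDet (f N ⨯₃ f (N + 1)) ≠ 0 := by
    intro hD
    have := one_le_of_symDet_eq_zero hb hD p3 hq hr hxy p1 hsN hrs (by linarith)
    have hxA : x * (2 * (y * y ^ (-τ))) * (2 + 2 * |ζ|)
        ≤ y * (2 * (y * y ^ (-τ))) * (2 + 2 * |ζ|) := by gcongr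
    linarith
  have hw0 := cross_zero_bound hq hr
  refine ⟨hD, hα', hw0, ?_, ?_⟩
  · have := one_le_of_det_ne_zero hb p3 hq hr le_rfl hxy p1 p2 (hdrop.le.trans p2)
    have e : x ^ (τ - 1) * (x * x ^ (-τ)) = 1 := by
      rw [← Real.rpow_one_add' hx0.le (by linarith), ← Real.rpow_add hx0,
        show τ - 1 + (1 + -τ) = 0 by ring, Real.rpow_zero]
    calc x ^ (τ - 1) ≤ x ^ (τ - 1) * (6 * (x * y * x ^ (-τ))) :=
          le_mul_of_one_le_right (Real.rpow_nonneg hx0.le _) this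
      _ = 6 * y * (x ^ (τ - 1) * (x * x ^ (-τ))) := by ring
      _ = 6 * y := by rw [e, mul_one]
  · have hκ := cross_osc_bound hq' hr hsN hrs
    have h1 := half_le_of_symDet_ne_zero hD hα'
    have h2 := mul_le_mul hw0 hκ (abs_nonneg _) (by positivity)
    have h3 : 1 ≤ 8 * (1 + 2 * |ζ|) * x * (y ^ 2 * y ^ (-τ)) := by linarith
    have e : y ^ (τ - 2) * (y ^ 2 * y ^ (-τ)) = 1 := by
      rw [← Real.rpow_two, ← Real.rpow_add hy0, ← Real.rpow_add hy0,
        show τ - 2 + (2 + -τ) = 0 by ring, Real.rpow_zero]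
    calc y ^ (τ - 2) ≤ y ^ (τ - 2) * (8 * (1 + 2 * |ζ|) * x * (y ^ 2 * y ^ (-τ))) :=
          le_mul_of_one_le_right (Real.rpow_nonneg hy0.le _) h3
      _ = 8 * (1 + 2 * |ζ|) * x * (y ^ (τ - 2) * (y ^ 2 * y ^ (-τ))) := by ring
      _ = _ := by rw [e, mul_one]

theorem exists_consecutive_breaks (hζ : ∀ p : Fin 3 → ℤ, p ≠ 0 → quadEval ζ p ≠ 0)
    (hf : IsMinSeq ζ f) {τ : ℝ} (hτ : 2 < τ) {N₀ : ℕ}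
    (hs : ∀ N : ℕ, N₀ ≤ N → |quadEval ζ (f N)| ≤ ((N : ℝ) + 1) ^ (-τ)) :
    ∃ C : ℝ, 1 ≤ C ∧ ∃ Z₀ : ℕ, ∀ Z, Z₀ ≤ Z → ∃ (P Q : Fin 3 → ℤ) (x y x' y' : ℝ),
      symDet (P ⨯₃ Q) ≠ 0 ∧ (∀ i, |(P i : ℝ)| ≤ x) ∧ (∀ i, |(Q i : ℝ)| ≤ x') ∧
      |quadEval ζ P| ≤ y ^ (-τ) ∧ |quadEval ζ Q| ≤ y' ^ (-τ) ∧
      1 ≤ x ∧ 1 ≤ y ∧ 1 ≤ x' ∧ 1 ≤ y' ∧ y ≤ (Z : ℝ) + 1 ∧ (Z : ℝ) + 1 ≤ y' ∧ y ≤ x' ∧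
      x ^ (τ - 1) ≤ C * y ∧ y ^ (τ - 2) ≤ C * x ∧ x' ^ (τ - 1) ≤ C * (x * y) ∧
      y' ^ (τ - 2) ≤ C * x' ∧ x' ^ (τ - 1) ≤ C * y' := by
  obtain ⟨M, hM⟩ := IsBreak.facts hζ hf hτ hs
  obtain ⟨H, hH1, hH⟩ := exists_mul_rpow_neg_lt 2 (by linarith : 0 < τ - 1)
    (by norm_num : (0 : ℝ) < 1 / 2)
  obtain ⟨M', hM'⟩ := hf.exists_le_height hζ (by linarith : 0 < τ) hs (max H (N₀ + 2))
  have hz := abs_nonneg ζ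
  obtain ⟨Z₀, hZ₀, hbZ₀⟩ := hf.exists_isBreak hζ (by linarith : 1 < τ) hs (M + M' + N₀ + 1)
  refine ⟨8 * (1 + 2 * |ζ|), by linarith, Z₀, fun Z hZ => ?_⟩
  classical
  obtain ⟨N, hNZ, hN0, hbN, hmax⟩ : ∃ N, N ≤ Z ∧ Z₀ ≤ N ∧ IsBreak f N ∧
      ∀ J, N < J → J ≤ Z → ¬ IsBreak f J :=
    ⟨Nat.findGreatest (IsBreak f) Z, Nat.findGreatest_le _, Nat.le_findGreatest hZ hbZ₀,
      Nat.findGreatest_spec hZ hbZ₀, fun J h1 h2 => Nat.findGreatest_is_greatest h1 h2⟩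
  obtain ⟨N', hN'Z, hbN', hmin⟩ : ∃ N', Z + 1 ≤ N' ∧ IsBreak f N' ∧
      ∀ J, Z + 1 ≤ J → J < N' → ¬ IsBreak f J := by
    have hex := hf.exists_isBreak hζ (by linarith : 1 < τ) hs (Z + 1)
    exact ⟨Nat.find hex, (Nat.find_spec hex).1, (Nat.find_spec hex).2,
      fun J h1 h2 h3 => Nat.find_min hex h2 ⟨h1, h3⟩⟩
  have hnb : ∀ J, N < J → J < N' → ¬ IsBreak f J := fun J h1 h2 => by
    rcases Nat.lt_or_ge Z J with h | h
    · exact hmin J h h2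
    · exact hmax J h1 h
  have hN1 : 1 ≤ N := by omega
  have hdrop := hbN.drop hζ hf hN1
  have hgt := hf.height_gt hN1 hdrop (K := N') (by omega)
  have hle := hf.height_le N hN1
  have hle' := hf.height_le N' (by omega)
  have d0 := hf.dot_eq_zero hζ hN1 hdrop hnb N le_rfl (by omega)
  have d1 := hf.dot_eq_zero hζ hN1 hdrop hnb N' (by omega) le_rfl
  have d2 := hf.dot_eq_zero hζ hN1 hdrop hnb (height3 (f N') - 1) (by omega) (by omega)
  obtain ⟨a1, a2, a3, a4, a5⟩ := hM N (by omega) hbN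
  obtain ⟨-, -, -, a4', a5'⟩ := hM N' (by omega) hbN'
  have hht' := hM' N' (by omega)
  obtain ⟨p1, p2, p3⟩ := hf.pred_le hs (K := N') (by omega) (by omega)
  have hposN := height3_pos (hf.ne_zero N)
  have hPQ0 : f N ⨯₃ f N' ≠ 0 := cross_ne_zero_of_height_lt hζ (hf.ne_zero _) (hf.ne_zero _)
    (by omega) (hf.anti hN1 (by omega))
  have swap : ∀ u v : Fin 3 → ℤ, u ⨯₃ v = 0 → v ⨯₃ u = 0 := fun u v h => by
    rw [← cross_anticomm, h, neg_zero]
  have hc0 := hf.cross_pred_ne_zero hζ (K := N') (by omega) (by omega)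
  have hprop := swap _ _ (cross_cross_eq_zero d2 d1)
  have hD' := symDet_ne_zero_of_proportional a1 hc0 hprop
  have hα := cross_one_bound p3 (abs_le_height3 (f N')) p1 p2
  have hκ := cross_osc_bound p3 (abs_le_height3 (f N')) p1 p2
  set x' : ℝ := (height3 (f N') : ℝ) with hx'
  have hHx' : (H : ℝ) ≤ x' := by rw [hx']; exact_mod_cast (by omega : H ≤ height3 (f N'))
  have hx1' : 1 ≤ x' := le_trans (by exact_mod_cast hH1) hHx'
  have hx0' : 0 < x' := by linarith
  have e : x' ^ (-(τ - 1)) = x' * x' ^ (-τ) := by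
    rw [show -(τ - 1) = 1 + -τ by ring, Real.rpow_add hx0', Real.rpow_one]
  have fx' := hH x' hHx'
  rw [e] at fx'
  have hhalf := half_le_of_proportional a1 hD' a2 (by linarith) hprop
  have e1 : (1 : ℝ) ≤ height3 (f N) := by exact_mod_cast hposN
  have e2 : (0 : ℝ) ≤ N := Nat.cast_nonneg N
  have e3 : (0 : ℝ) ≤ N' := Nat.cast_nonneg N'
  refine ⟨f N, f N', height3 (f N), (N : ℝ) + 1, x', (N' : ℝ) + 1,
    symDet_ne_zero_of_proportional a1 hPQ0 (swap _ _ (cross_cross_eq_zero d0 d1)),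
    abs_le_height3 _, abs_le_height3 _, hs N (by omega), hs N' (by omega), e1, by linarith, hx1',
    by linarith, by gcongr, ?_, ?_, a4.trans ?_, a5, ?_, a5', a4'.trans ?_⟩
  · have : (Z : ℝ) + 1 ≤ N' := by exact_mod_cast hN'Z
    linarith
  · rw [hx']; exact_mod_cast hgt
  · gcongr; linarith
  · have h2 := mul_le_mul a3 hκ (abs_nonneg _) (by positivity)
    have h3 : 1 ≤ 8 * (1 + 2 * |ζ|) * (height3 (f N) * ((N : ℝ) + 1)) * (x' * x' ^ (-τ)) := by
      linarith
    have e : x' ^ (τ - 1) * (x' * x' ^ (-τ)) = 1 := by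
      rw [← Real.rpow_one_add' hx0'.le (by linarith), ← Real.rpow_add hx0',
        show τ - 1 + (1 + -τ) = 0 by ring, Real.rpow_zero]
    calc x' ^ (τ - 1) ≤ x' ^ (τ - 1) * _ :=
          le_mul_of_one_le_right (Real.rpow_nonneg hx0'.le _) h3
      _ = 8 * (1 + 2 * |ζ|) * (height3 (f N) * ((N : ℝ) + 1))
          * (x' ^ (τ - 1) * (x' * x' ^ (-τ))) := by ring
      _ = _ := by rw [e, mul_one]
  · gcongr; linarith

end IsMinSeq

theorem abs_coeff_le_polyH (P : Polynomial ℤ) (i : ℕ) : |(P.coeff i : ℝ)| ≤ polyH P := by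
  have h : (P.coeff i).natAbs ≤ P.support.sup fun i => (P.coeff i).natAbs := by
    by_cases hi : i ∈ P.support
    · exact Finset.le_sup (f := fun i => (P.coeff i).natAbs) hi
    · simp [Polynomial.notMem_support_iff.1 hi]
  have h' : ((P.coeff i).natAbs : ℝ) ≤ polyH P := by
    unfold polyH; exact_mod_cast h
  rwa [Nat.cast_natAbs, Int.cast_abs] at h'

theorem quadEval_coeff {P : Polynomial ℤ} (hP : P.natDegree ≤ 2) (ζ : ℝ) :
    quadEval ζ (fun i : Fin 3 => P.coeff i) = pev ζ P := by
  rw [pev, Polynomial.aeval_eq_sum_range' (n := 3) (by omega)]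
  simp [quadEval, Finset.sum_range_succ]

theorem Transcendental.aeval_int_ne_zero {ζ : ℝ} (hζ : Transcendental ℚ ζ) {P : Polynomial ℤ}
    (hP : P ≠ 0) : Polynomial.aeval ζ P ≠ 0 := fun h =>
  hζ ((IsFractionRing.isAlgebraic_iff ℤ ℚ ℝ).1 ⟨P, hP, h⟩)

theorem Transcendental.quadEval_ne_zero {ζ : ℝ} (hζ : Transcendental ℚ ζ) (p : Fin 3 → ℤ)
    (hp : p ≠ 0) : quadEval ζ p ≠ 0 := by
  have h := hζ.aeval_int_ne_zero (P := C (p 0) + C (p 1) * X + C (p 2) * X ^ 2) fun h0 => hp ?_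
  · simpa [quadEval] using h
  · have h1 := congrArg (fun P => P.coeff 0) h0
    have h2 := congrArg (fun P => P.coeff 1) h0
    have h3 := congrArg (fun P => P.coeff 2) h0
    simp only [Polynomial.coeff_add, Polynomial.coeff_C_mul, Polynomial.coeff_X,
      Polynomial.coeff_X_pow, Polynomial.coeff_C, Polynomial.coeff_zero] at h1 h2 h3
    norm_num at h1 h2 h3
    funext i
    fin_cases i <;> assumption

theorem IsExtremal.minSeq_small {ζ : ℝ} (hζ : IsExtremal ζ) {f : ℕ → Fin 3 → ℤ}
    (hf : IsMinSeq ζ f) {τ : ℝ} (hτ0 : 0 < τ) (hτ : τ < Real.goldenRatio + 1) :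
    ∃ N₀ : ℕ, ∀ N : ℕ, N₀ ≤ N → |quadEval ζ (f N)| ≤ ((N : ℝ) + 1) ^ (-τ) := by
  have hsup : τ < sSup (whSet 2 ζ) := by
    have := hζ.2
    rw [whExp] at this
    rw [this]
    refine hτ.trans_le (le_of_eq ?_)
    rw [Real.goldenRatio]; ring
  have hne : (whSet 2 ζ).Nonempty := by
    by_contra h
    rw [Set.not_nonempty_iff_eq_empty] at h
    rw [h, Real.sSup_empty] at hsup
    linarith
  obtain ⟨η, ⟨X₀, hX₀⟩, hη⟩ := exists_lt_of_lt_csSup hne hsup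
  obtain ⟨H, hH1, hH⟩ := exists_mul_rpow_neg_lt (2 ^ τ) (by linarith : 0 < η - τ) one_pos
  obtain ⟨n, hn⟩ := exists_nat_ge X₀
  refine ⟨max H n, fun N hN => ?_⟩
  have hHN : (H : ℝ) ≤ N := by exact_mod_cast le_of_max_le_left hN
  have hnN : (n : ℝ) ≤ N := by exact_mod_cast le_of_max_le_right hN
  obtain ⟨P, hdeg, hht, hpos, hle⟩ := hX₀ N (by linarith)
  have hN1 : 1 ≤ N := hH1.trans (le_of_max_le_left hN)
  have hN1' : (1 : ℝ) ≤ N := by exact_mod_cast hN1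
  have hN0 : (0 : ℝ) < N := by linarith
  have hv := quadEval_coeff hdeg ζ
  have h1 : |quadEval ζ (f N)| ≤ (N : ℝ) ^ (-η) := by
    rw [← hv] at hle hpos
    refine (hf.min N hN1 _ ?_ ?_).trans hle
    · intro h
      rw [h] at hpos
      simp [quadEval] at hpos
    · rw [height3_le]
      intro i
      have := (abs_coeff_le_polyH P i).trans hht
      exact_mod_cast this
  refine h1.trans ?_
  have h2 := (hH N hHN).le
  have e : (N : ℝ) ^ (-η) = N ^ (-(η - τ)) * N ^ (-τ) := by
    rw [← Real.rpow_add hN0]; congr 1; ring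
  have e2 : (2 * (N : ℝ)) ^ (-τ) = (2 ^ τ)⁻¹ * N ^ (-τ) := by
    rw [Real.mul_rpow (by norm_num) hN0.le, Real.rpow_neg (by norm_num : (0 : ℝ) ≤ 2)]
  calc (N : ℝ) ^ (-η) = N ^ (-(η - τ)) * N ^ (-τ) := e
    _ ≤ (2 ^ τ)⁻¹ * N ^ (-τ) := by
        gcongr
        rw [← one_div, le_div_iff₀ (by positivity)]
        linarith
    _ = (2 * (N : ℝ)) ^ (-τ) := e2.symm
    _ ≤ ((N : ℝ) + 1) ^ (-τ) :=
        Real.rpow_le_rpow_of_nonpos (by linarith) (by linarith) (by linarith)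

/-- Consequences of the logarithmic inequalities between heights of consecutive minimal pairs. -/
theorem log_height_bounds {g μ c a b a' b' s : ℝ} (hg : g ^ 2 = g + 1) (hg1 : 1.61 < g)
    (hg2 : g < 1.62) (hμ : 0 < μ) (hμ1 : μ ≤ 1 / 100) (hc : 0 ≤ c) (ha : 0 ≤ a) (hb : 0 ≤ b)
    (ha' : 0 ≤ a') (hb' : 0 ≤ b') (hs : 8 * c + 6 * (c / μ) ≤ s)
    (h1 : (g - μ) * a ≤ c + b) (h2 : (g - 1 - μ) * b ≤ c + a) (h3 : (g - μ) * a' ≤ c + (a + b))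
    (h4 : (g - 1 - μ) * b' ≤ c + a') (h5 : (g - μ) * a' ≤ c + b') (h6 : b ≤ s + c) (h7 : s ≤ b')
    (h8 : b ≤ a') :
    a' ≤ (g + 100 * μ) * a ∧ (2 * g + 1 - 100 * μ) * a ≤ (g + 1 - μ) * b ∧
    (3 * g + 2 - 100 * μ) * a ≤ (g + 1 - μ) * b' ∧ (g - 100 * μ) * a ≤ s ∧
    s ≤ (g + 1 + 100 * μ) * a := by
  have k1 : b ≤ 2 * (c + a) := by
    linarith [mul_nonneg hb (by linarith : 0 ≤ g - 1 - μ - 0.6)]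
  have k2 : a' ≤ 3 * c + 3 * a := by
    linarith [mul_nonneg ha' (by linarith : 0 ≤ g - μ - 1.6)]
  have k3 : b' ≤ 8 * c + 6 * a := by
    linarith [mul_nonneg hb' (by linarith : 0 ≤ g - 1 - μ - 0.6)]
  have k4 : c / μ ≤ a := by linarith
  have hcm : c ≤ μ * a := by rw [div_le_iff₀ hμ] at k4; linarith
  have hma : μ * a ≤ 1 / 100 * a := by gcongr
  set m := μ * a with hm
  have hm0 : 0 ≤ m := by positivity
  have k5 : b ≤ 4 * a := by linarith
  have k6 : a' ≤ 6 * a := by linarith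
  have k7 : b' ≤ 14 * a := by linarith
  have m5 : μ * b ≤ 4 * m := by linarith [mul_le_mul_of_nonneg_left k5 hμ.le]
  have m6 : μ * a' ≤ 6 * m := by linarith [mul_le_mul_of_nonneg_left k6 hμ.le]
  have m7 : μ * b' ≤ 14 * m := by linarith [mul_le_mul_of_nonneg_left k7 hμ.le]
  have gm1 : g * m ≤ 1.62 * m := by gcongr
  have gm2 : 1.61 * m ≤ g * m := by gcongr
  have ub : b ≤ g * a + 10 * m := by
    have e : (g - 1) * b ≤ a + 5 * m := by linarith
    have := mul_le_mul_of_nonneg_left e (by linarith : 0 ≤ g)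
    have e2 : g * ((g - 1) * b) = b := by linear_combination b * hg
    linarith [gm1, gm2]
  have ua' : a' ≤ g * a + 11 * m := by
    have e : g * a' ≤ (g + 1) * a + 17 * m := by linarith
    have := mul_le_mul_of_nonneg_left e (by linarith : 0 ≤ g - 1)
    have e2 : (g - 1) * (g * a') = a' := by linear_combination a' * hg
    have e3 : (g - 1) * ((g + 1) * a + 17 * m) = g * a + (g - 1) * (17 * m) := by
      linear_combination a * hg
    linarith [gm1, gm2]
  have ub' : b' ≤ (g + 1) * a + 50 * m := by
    have e : (g - 1) * b' ≤ g * a + 26 * m := by linarith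
    have := mul_le_mul_of_nonneg_left e (by linarith : 0 ≤ g)
    have e2 : g * ((g - 1) * b') = b' := by linear_combination b' * hg
    have e3 : g * (g * a + 26 * m) = (g + 1) * a + g * (26 * m) := by
      linear_combination a * hg
    linarith [gm1, gm2]
  have lb : g * a - 2 * m ≤ b := by linarith
  have lb' : (g + 1) * a - 12 * m ≤ b' := by
    have e : g * a' ≤ b' + 7 * m := by linarith
    have e1 := mul_le_mul_of_nonneg_left (lb.trans h8) (by linarith : 0 ≤ g)
    have e2 : g * (g * a - 2 * m) = (g + 1) * a - g * (2 * m) := by linear_combination a * hg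
    linarith [gm1, gm2]
  refine ⟨by linarith, ?_, ?_, by linarith, by linarith⟩
  · have e1 := mul_le_mul_of_nonneg_left lb (by linarith : 0 ≤ g + 1)
    have e2 : (g + 1) * (g * a - 2 * m) = (2 * g + 1) * a - (g + 1) * (2 * m) := by
      linear_combination a * hg
    linarith [gm1, gm2]
  · have e1 := mul_le_mul_of_nonneg_left lb' (by linarith : 0 ≤ g + 1)
    have e2 : (g + 1) * ((g + 1) * a - 12 * m) = (3 * g + 2) * a - (g + 1) * (12 * m) := by
      linear_combination a * hg
    linarith [gm1, gm2]

theorem goldenRatio_bounds : 1.618 < Real.goldenRatio ∧ Real.goldenRatio < 1.6181 := by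
  have h := Real.goldenRatio_sq
  have h1 := Real.one_lt_goldenRatio
  constructor <;> nlinarith

/-- For an extremal number there are, at every scale, pairs of coprime quadratic polynomials whose
heights and values follow the golden ratio. -/
theorem IsExtremal.exists_pairs {ζ : ℝ} (hζ : IsExtremal ζ) {ε : ℝ} (hε : 0 < ε) :
    ∃ s₀ : ℝ, ∀ s, s₀ ≤ s → ∃ (t : ℝ) (P Q : Fin 3 → ℤ), 0 ≤ t ∧ symDet (P ⨯₃ Q) ≠ 0 ∧
      (∀ i, |(P i : ℝ)| ≤ Real.exp t) ∧
      (∀ i, |(Q i : ℝ)| ≤ Real.exp ((Real.goldenRatio + ε) * t)) ∧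
      |quadEval ζ P| ≤ Real.exp (-((2 * Real.goldenRatio + 1 - ε) * t)) ∧
      |quadEval ζ Q| ≤ Real.exp (-((3 * Real.goldenRatio + 2 - ε) * t)) ∧
      (Real.goldenRatio - ε) * t ≤ s ∧ s ≤ (Real.goldenRatio + 1 + ε) * t := by
  obtain ⟨g1, g2⟩ := goldenRatio_bounds
  have hg := Real.goldenRatio_sq
  set g := Real.goldenRatio with hgdef
  set μ : ℝ := min ε 1 / 100 with hμdef
  have hμ : 0 < μ := by have : 0 < min ε 1 := lt_min hε one_pos; positivity
  have hμ1 : μ ≤ 1 / 100 := by rw [hμdef]; gcongr; exact min_le_right _ _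
  have hμε : 100 * μ ≤ ε := by rw [hμdef]; linarith [min_le_left ε 1]
  obtain ⟨f, hf⟩ := exists_isMinSeq ζ
  obtain ⟨N₀, hN₀⟩ := hζ.minSeq_small hf (τ := g + 1 - μ) (by linarith) (by linarith)
  obtain ⟨C, hC, Z₀, hZ₀⟩ := hf.exists_consecutive_breaks hζ.1.quadEval_ne_zero
    (τ := g + 1 - μ) (by linarith) hN₀
  set c : ℝ := Real.log C + 1 with hcdef
  have hlogC : 0 ≤ Real.log C := Real.log_nonneg hC
  refine ⟨max (8 * c + 6 * (c / μ)) (Z₀ : ℝ), fun s hs => ?_⟩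
  have hs1 := (le_max_left _ _).trans hs
  have hs2 := (le_max_right _ _).trans hs
  have hZ : Z₀ ≤ ⌊Real.exp s⌋₊ := by
    apply Nat.le_floor
    linarith [Real.add_one_le_exp s]
  obtain ⟨P, Q, x, y, x', y', hD, hP, hQ, hPv, hQv, hx, hy, hx', hy', e6, e7, e8, e1, e2, e3, e4,
    e5⟩ := hZ₀ _ hZ
  have hfl := Nat.floor_le (Real.exp_pos s).le
  have hfl' := Nat.lt_floor_add_one (Real.exp s)
  have hs0 : 0 ≤ s := (Nat.cast_nonneg _).trans hs2
  have hexp1 : 1 ≤ Real.exp s := Real.one_le_exp hs0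
  have lg : ∀ {u v w : ℝ}, 1 ≤ u → 1 ≤ v → u ^ w ≤ C * v → w * Real.log u ≤ c + Real.log v := by
    intro u v w hu hv h
    have := Real.log_le_log (Real.rpow_pos_of_pos (by linarith) _) h
    rw [Real.log_rpow (by linarith), Real.log_mul (by linarith) (by linarith)] at this
    linarith
  have l1 := lg hx hy e1
  have l2 := lg hy hx e2
  have l3 := lg hx' (one_le_mul_of_one_le_of_one_le hx hy) e3
  rw [Real.log_mul (by linarith) (by linarith)] at l3
  have l4 := lg hy' hx' e4
  have l5 := lg hx' hy' e5
  have l8 := Real.log_le_log (by linarith) e8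
  have l7 : s ≤ Real.log y' := by
    rw [Real.le_log_iff_exp_le (by linarith)]; linarith
  have l6 : Real.log y ≤ s + c := by
    rw [Real.log_le_iff_le_exp (by linarith), Real.exp_add]
    have : 2 ≤ Real.exp c := by
      have := Real.add_one_le_exp c
      linarith
    nlinarith
  have ha := Real.log_nonneg hx
  obtain ⟨r1, r2, r3, r4, r5⟩ := log_height_bounds hg (by linarith) (by linarith) hμ hμ1
    (by linarith) ha (Real.log_nonneg hy) (Real.log_nonneg hx') (Real.log_nonneg hy') hs1
    (by convert l1 using 2; ring) (by convert l2 using 2; ring) (by convert l3 using 2; ring)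
    (by convert l4 using 2; ring) (by convert l5 using 2; ring) l6 l7 l8
  have hm := mul_le_mul_of_nonneg_right hμε ha
  refine ⟨Real.log x, P, Q, ha, hD, ?_, ?_, ?_, ?_, by linarith, by linarith⟩
  · intro i; rw [Real.exp_log (by linarith)]; exact hP i
  · intro i
    refine (hQ i).trans ?_
    rw [← Real.log_le_iff_le_exp (by linarith)]; linarith
  · refine hPv.trans ?_
    rw [Real.rpow_def_of_pos (by linarith), Real.exp_le_exp]; linarith
  · refine hQv.trans ?_
    rw [Real.rpow_def_of_pos (by linarith), Real.exp_le_exp]; linarith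

/-- `ζ` is approximated by integer linear forms to exponent `1 + δ`, for arbitrarily large heights
`Real.exp r`. -/
def HasGoodLinearForms (ζ δ : ℝ) : Prop :=
  ∀ r₀ : ℝ, ∃ r, r₀ ≤ r ∧ ∃ a b : ℤ, (a ≠ 0 ∨ b ≠ 0) ∧ |(a : ℝ)| ≤ Real.exp r ∧
    |(b : ℝ)| ≤ Real.exp r ∧ |a * ζ + b| ≤ Real.exp (-((1 + δ) * r))

theorem ne_zero_or_ne_zero_of_symDet_ne_zero {w : Fin 3 → ℤ} (hw : symDet w ≠ 0) {a b : ℤ}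
    (hab : a ≠ 0 ∨ b ≠ 0) : b * w 0 + a * w 1 ≠ 0 ∨ b * w 1 + a * w 2 ≠ 0 := by
  by_contra! h
  obtain ⟨h1, h2⟩ := h
  rcases hab with ha | hb
  · have : a * symDet w = 0 := by
      simp only [symDet]; linear_combination w 0 * h2 - w 1 * h1
    exact (mul_ne_zero ha hw) this
  · have : b * symDet w = 0 := by
      simp only [symDet]; linear_combination w 2 * h1 - w 1 * h2
    exact (mul_ne_zero hb hw) this

theorem contracted_form_bounds {ζ a b w₀ w₁ w₂ R V H E : ℝ} (ha : |a| ≤ R) (hb : |b| ≤ R)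
    (hv : |a * ζ + b| ≤ V) (h0 : |w₀| ≤ 2 * H) (h1 : |w₁ - ζ * w₀| ≤ 2 * E)
    (h2 : |w₂ - ζ ^ 2 * w₀| ≤ 2 * E) :
    |b * w₀ + a * w₁| ≤ 2 * (H * V) + 2 * (R * E) ∧
    |(b * w₀ + a * w₁) * ζ - (b * w₁ + a * w₂)| ≤ (4 + 2 * |ζ|) * (R * E) := by
  have hR := (abs_nonneg _).trans ha
  have hE : 0 ≤ E := by linarith [(abs_nonneg _).trans h1]
  have hV := (abs_nonneg _).trans hv
  constructor
  · have e : b * w₀ + a * w₁ = w₀ * (a * ζ + b) + a * (w₁ - ζ * w₀) := by ring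
    rw [e]
    refine (abs_add_le _ _).trans ?_
    rw [abs_mul, abs_mul]
    have := mul_le_mul h0 hv (abs_nonneg _) (by linarith [(abs_nonneg _).trans h0])
    have := mul_le_mul ha h1 (abs_nonneg _) hR
    linarith
  · have h3 : |w₂ - ζ * w₁| ≤ (2 + 2 * |ζ|) * E := by
      have e : w₂ - ζ * w₁ = (w₂ - ζ ^ 2 * w₀) - ζ * (w₁ - ζ * w₀) := by ring
      rw [e]
      refine (abs_sub _ _).trans ?_
      rw [abs_mul]
      have := mul_le_mul_of_nonneg_left h1 (abs_nonneg ζ)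
      linarith
    have e : (b * w₀ + a * w₁) * ζ - (b * w₁ + a * w₂)
      = -(b * (w₁ - ζ * w₀) + a * (w₂ - ζ * w₁)) := by ring
    rw [e, abs_neg]
    refine (abs_add_le _ _).trans ?_
    rw [abs_mul, abs_mul]
    have := mul_le_mul hb h1 (abs_nonneg _) hR
    have := mul_le_mul ha h3 (abs_nonneg _) hR
    linarith

theorem eq_zero_of_abs_le_exp {n : ℤ} {x : ℝ} (h : |(n : ℝ)| ≤ Real.exp x) (hx : x < 0) :
    n = 0 := by
  by_contra hn
  have h1 := one_le_abs_cast hn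
  linarith [Real.exp_lt_exp.2 hx, Real.exp_zero]

theorem HasGoodLinearForms.improve {ζ δ : ℝ} (h : HasGoodLinearForms ζ δ) (hζ : IsExtremal ζ)
    (hδ : 0 < δ) : δ < 4 ∧ HasGoodLinearForms ζ (3 / 2 * δ) := by
  obtain ⟨g1, g2⟩ := goldenRatio_bounds
  have hg := Real.goldenRatio_sq
  set g := Real.goldenRatio with hgdef
  set κ : ℝ := min δ 1 / 1000 with hκdef
  have hκ : 0 < κ := by have : 0 < min δ 1 := lt_min hδ one_pos; positivity
  have hκ1 : κ ≤ 1 / 1000 := by rw [hκdef]; gcongr; exact min_le_right _ _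
  have hκδ : 1000 * κ ≤ δ := by rw [hκdef]; linarith [min_le_left δ 1]
  set ε : ℝ := κ / (1 + δ) with hεdef
  have hε : 0 < ε := by positivity
  have hεκ : ε * (1 + δ) = κ := by rw [hεdef]; field_simp
  have hε1 : ε ≤ κ := by nlinarith
  obtain ⟨s₀, hs₀⟩ := hζ.exists_pairs hε
  set C : ℝ := 4 + 6 * |ζ| with hCdef
  have hC : 4 ≤ C := by have := abs_nonneg ζ; linarith
  have key : ∀ r₀ : ℝ, δ < 4 ∧ ∃ r, r₀ ≤ r ∧ ∃ a b : ℤ, (a ≠ 0 ∨ b ≠ 0) ∧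
      |(a : ℝ)| ≤ Real.exp r ∧ |(b : ℝ)| ≤ Real.exp r ∧
      |a * ζ + b| ≤ Real.exp (-((1 + 3 / 2 * δ) * r)) := by
    intro r₀
    obtain ⟨r, hr, a, b, hab, ha, hb, hv⟩ := h (max (max s₀ 1) (max (r₀ / κ) (Real.log C / κ)))
    have hr1 : s₀ ≤ r := ((le_max_left _ _).trans (le_max_left _ _)).trans hr
    have hr2 : 1 ≤ r := ((le_max_right _ _).trans (le_max_left _ _)).trans hr
    have hr3 : r₀ / κ ≤ r := ((le_max_left _ _).trans (le_max_right _ _)).trans hr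
    have hr4 : Real.log C / κ ≤ r := ((le_max_right _ _).trans (le_max_right _ _)).trans hr
    rw [div_le_iff₀ hκ] at hr3 hr4
    have hCr : C ≤ Real.exp (κ * r) := by
      rw [← Real.log_le_iff_le_exp (by linarith)]; linarith
    have hr0 : 0 < r := by linarith
    have hδr : 0 < δ * r := by positivity
    have hκr : 0 < κ * r := by positivity
    obtain ⟨t, P, Q, ht, hD, hP, hQ, hPv, hQv, ht1, ht2⟩ := hs₀ ((1 + δ / 2) * r) (by nlinarith)
    have htr : t ≤ (1 + δ) * r := by
      have : 0 ≤ (g - ε - 1) * t := mul_nonneg (by linarith) ht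
      nlinarith
    have hεt : ε * t ≤ κ * r := by
      have := mul_le_mul_of_nonneg_left htr hε.le
      rw [← mul_assoc, hεκ] at this; exact this
    have hεt0 : 0 ≤ ε * t := by positivity
    set W := P ⨯₃ Q with hW
    have hP' : ∀ i, |(P i : ℝ)| ≤ Real.exp ((g + ε) * t) := fun i => (hP i).trans <| by
      rw [Real.exp_le_exp]
      nlinarith
    have hQv' : |quadEval ζ Q| ≤ Real.exp (-((2 * g + 1 - ε) * t)) := hQv.trans <| by
      rw [Real.exp_le_exp]
      nlinarith
    have w0 := cross_zero_bound hP hQ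
    have w1 := cross_one_bound hP' hQ hPv hQv'
    have w2 := cross_two_bound hP' hQ hPv hQv'
    rw [← hW] at w0 w1 w2
    obtain ⟨b1, b2⟩ := contracted_form_bounds ha hb hv w0 w1 w2
    rw [← Real.exp_add, ← Real.exp_add, ← Real.exp_add, ← Real.exp_add] at b1
    rw [← Real.exp_add, ← Real.exp_add] at b2
    set r' : ℝ := (g + 1) * t - (1 + δ) * r + 6 * (κ * r) with hr'
    have x1 : Real.exp (t + (g + ε) * t + -((1 + δ) * r)) ≤ Real.exp (r' - 2 * (κ * r)) := by
      rw [Real.exp_le_exp, hr']; linarith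
    have x2 : Real.exp (r + ((g + ε) * t + -((2 * g + 1 - ε) * t)))
        ≤ Real.exp (r' - 2 * (κ * r)) := by
      rw [Real.exp_le_exp, hr']; linarith
    have c1 : |((b * W 0 + a * W 1 : ℤ) : ℝ)| ≤ 4 * Real.exp (r' - 2 * (κ * r)) := by
      push_cast; linarith
    have c2 : |((b * W 1 + a * W 2 : ℤ) : ℝ)| ≤ C * Real.exp (r' - 2 * (κ * r)) := by
      push_cast at c1 ⊢
      have e : (b * W 1 + a * W 2 : ℝ)
        = (b * W 0 + a * W 1) * ζ - ((b * W 0 + a * W 1) * ζ - (b * W 1 + a * W 2)) := by ring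
      rw [e]
      refine (abs_sub _ _).trans ?_
      rw [abs_mul]
      have := mul_le_mul_of_nonneg_right c1 (abs_nonneg ζ)
      have := mul_le_mul_of_nonneg_left x2 (by have := abs_nonneg ζ; linarith : 0 ≤ 4 + 2 * |ζ|)
      rw [hCdef]
      linarith
    have c3 : C * Real.exp (r' - 2 * (κ * r)) ≤ Real.exp (r' - κ * r) := by
      refine (mul_le_mul_of_nonneg_right hCr (Real.exp_pos _).le).trans ?_
      rw [← Real.exp_add, Real.exp_le_exp]; linarith
    have c1' : |((b * W 0 + a * W 1 : ℤ) : ℝ)| ≤ Real.exp (r' - κ * r) :=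
      c1.trans ((mul_le_mul_of_nonneg_right hC (Real.exp_pos _).le).trans c3)
    have c2' := c2.trans c3
    have hne := ne_zero_or_ne_zero_of_symDet_ne_zero hD hab
    have hr'κ : κ * r ≤ r' := by
      by_contra! hlt
      rcases hne with h | h
      · exact h (eq_zero_of_abs_le_exp c1' (by linarith))
      · exact h (eq_zero_of_abs_le_exp c2' (by linarith))
    have hr'up : r' ≤ 0.63 * r - 0.18 * (δ * r) := by
      have e1 : g * t ≤ (1 + δ / 2) * r + κ * r := by linarith
      have e2 := mul_le_mul_of_nonneg_left e1 (by linarith : 0 ≤ g)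
      have e3 : g * (g * t) = (g + 1) * t := by linear_combination t * hg
      have e4 : g * ((1 + δ / 2) * r + κ * r) ≤ 1.6181 * ((1 + δ / 2) * r + κ * r) := by
        gcongr
      have e5 : κ * r ≤ 1 / 1000 * r := by gcongr
      have e6 := mul_le_mul_of_nonneg_right hκδ hr0.le
      rw [hr']
      linarith
    have hle : Real.exp (r' - κ * r) ≤ Real.exp r' := by rw [Real.exp_le_exp]; linarith
    refine ⟨?_, r', by linarith, b * W 0 + a * W 1, -(b * W 1 + a * W 2), ?_, c1'.trans hle, ?_,
      ?_⟩
    · by_contra! h4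
      have := mul_le_mul_of_nonneg_right h4 hr0.le
      linarith
    · rw [neg_ne_zero]; exact hne
    · push_cast at c2' ⊢
      rw [abs_neg]; exact c2'.trans hle
    · push_cast
      rw [← sub_eq_add_neg]
      refine b2.trans ?_
      have : 4 + 2 * |ζ| ≤ Real.exp (κ * r) := by
        have := abs_nonneg ζ; linarith
      refine (mul_le_mul_of_nonneg_right this (Real.exp_pos _).le).trans ?_
      rw [← Real.exp_add, Real.exp_le_exp]
      have f1 : δ * r' ≤ δ * (0.63 * r) := by
        apply mul_le_mul_of_nonneg_left _ hδ.le
        linarith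
      have f2 := mul_le_mul_of_nonneg_right hκδ hr0.le
      have f3 : r' - 6 * (κ * r) = (g + 1) * t - (1 + δ) * r := by rw [hr']; ring
      linarith
  exact ⟨(key 0).1, fun r₀ => (key r₀).2⟩

theorem IsExtremal.not_hasGoodLinearForms {ζ : ℝ} (hζ : IsExtremal ζ) {δ : ℝ} (hδ : 0 < δ) :
    ¬ HasGoodLinearForms ζ δ := by
  intro h
  have key : ∀ n : ℕ, HasGoodLinearForms ζ ((3 / 2) ^ n * δ) := by
    intro n
    induction n with
    | zero => simpa using h
    | succ n ih =>
      have := (ih.improve hζ (by positivity)).2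
      rwa [← mul_assoc, ← pow_succ'] at this
  obtain ⟨n, hn⟩ := pow_unbounded_of_one_lt (4 / δ) (by norm_num : (1 : ℝ) < 3 / 2)
  have h4 := ((key n).improve hζ (by positivity)).1
  rw [div_lt_iff₀ hδ] at hn
  linarith

theorem exists_linear_form_le (ζ : ℝ) {ρ : ℝ} (hρ : 0 ≤ ρ) :
    ∃ a b : ℤ, 0 < a ∧ (a : ℝ) ≤ Real.exp ρ ∧ |(b : ℝ)| ≤ (1 + |ζ|) * Real.exp ρ ∧
      |a * ζ + b| ≤ Real.exp (-ρ) := by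
  have h1 : 1 ≤ Real.exp ρ := Real.one_le_exp hρ
  have hN : 0 < ⌊Real.exp ρ⌋₊ := Nat.floor_pos.2 h1
  obtain ⟨j, k, hk, hkN, hv⟩ := Real.exists_int_int_abs_mul_sub_le ζ hN
  have hk0 : (0 : ℝ) < k := by exact_mod_cast hk
  have hk1 : (k : ℝ) ≤ Real.exp ρ := by
    have : (k : ℝ) ≤ (⌊Real.exp ρ⌋₊ : ℝ) := by exact_mod_cast hkN
    exact this.trans (Nat.floor_le (Real.exp_pos ρ).le)
  have hv1 : |k * ζ - j| ≤ Real.exp (-ρ) := by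
    rw [Real.exp_neg, ← one_div]
    exact hv.trans (one_div_le_one_div_of_le (Real.exp_pos _) (Nat.lt_floor_add_one _).le)
  refine ⟨k, -j, hk, hk1, ?_, ?_⟩
  · push_cast
    rw [abs_neg]
    have e : (j : ℝ) = k * ζ - (k * ζ - j) := by ring
    rw [e]
    refine (abs_sub _ _).trans ?_
    rw [abs_mul, abs_of_pos hk0]
    have := mul_le_mul_of_nonneg_right hk1 (abs_nonneg ζ)
    have : Real.exp (-ρ) ≤ 1 := Real.exp_le_one_iff.2 (by linarith)
    linarith
  · push_cast
    rwa [← sub_eq_add_neg]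

/-- At every scale there are two independent integer linear forms with the size predicted by
Minkowski's theorem. -/
theorem IsExtremal.exists_linear_pair {ζ : ℝ} (hζ : IsExtremal ζ) {ε : ℝ} (hε : 0 < ε) :
    ∃ t₀ : ℝ, ∀ t, t₀ ≤ t → ∀ α, 0 ≤ α → α ≤ 3 * t → ∃ a₁ b₁ a₂ b₂ : ℤ,
      a₁ * b₂ - a₂ * b₁ ≠ 0 ∧
      |(a₁ : ℝ)| ≤ Real.exp (α + ε * t) ∧ |(b₁ : ℝ)| ≤ Real.exp (α + ε * t) ∧
      |(a₂ : ℝ)| ≤ Real.exp (α + ε * t) ∧ |(b₂ : ℝ)| ≤ Real.exp (α + ε * t) ∧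
      |a₁ * ζ + b₁| ≤ Real.exp (-α + ε * t) ∧ |a₂ * ζ + b₂| ≤ Real.exp (-α + ε * t) := by
  obtain ⟨δ, hδ0, hδε, hδ1⟩ : ∃ δ : ℝ, 0 < δ ∧ δ ≤ ε / 16 ∧ δ ≤ 1 / 8 :=
    ⟨min (ε / 16) (1 / 8), lt_min (by positivity) (by norm_num), min_le_left _ _,
      min_le_right _ _⟩
  have hnot := hζ.not_hasGoodLinearForms hδ0
  simp only [HasGoodLinearForms, not_forall, not_exists, not_and, not_le] at hnot
  obtain ⟨r₀, hr₀⟩ := hnot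
  set c := Real.log (1 + |ζ|) with hc
  have hζ1 : 1 ≤ 1 + |ζ| := by linarith [abs_nonneg ζ]
  have hc0 : 0 ≤ c := Real.log_nonneg hζ1
  have hexpc : Real.exp c = 1 + |ζ| := Real.exp_log (by linarith)
  refine ⟨max (2 * r₀ / ε) (12 * c / ε), fun t ht α hα hα3 => ?_⟩
  have ht1 := (le_max_left _ _).trans ht
  have ht2 := (le_max_right _ _).trans ht
  rw [div_le_iff₀ hε] at ht1 ht2
  have ht0 : 0 ≤ t := by linarith
  set ρ := α + ε * t / 2 with hρ
  have hεt : 0 ≤ ε * t := by positivity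
  have hρ0 : 0 ≤ ρ := by positivity
  have hρr : r₀ ≤ ρ := by linarith
  obtain ⟨a₁, b₁, ha₁, ha₁', hb₁, hv₁⟩ := exists_linear_form_le ζ hρ0
  set ρ₁ := ρ + c with hρ₁
  have hρ₁0 : 0 ≤ ρ₁ := by positivity
  obtain ⟨a₂, b₂, ha₂, ha₂', hb₂, hv₂⟩ :=
    exists_linear_form_le ζ (ρ := (1 + δ) * ρ₁) (by positivity)
  rw [← hexpc, ← Real.exp_add] at hb₁ hb₂
  have pa₁ : (0 : ℝ) < a₁ := by exact_mod_cast ha₁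
  have pa₂ : (0 : ℝ) < a₂ := by exact_mod_cast ha₂
  have hδρ : δ * ρ₁ ≤ ε * t / 4 + c := by
    have e1 : δ * α ≤ ε / 16 * (3 * t) := mul_le_mul hδε hα3 hα (by positivity)
    have e2 : δ * (ε * t / 2 + c) ≤ 1 / 8 * (ε * t / 2 + c) := by gcongr
    have e3 : δ * ρ₁ = δ * α + δ * (ε * t / 2 + c) := by rw [hρ₁, hρ]; ring
    linarith
  have hδρ0 : 0 ≤ δ * ρ₁ := by positivity
  have e₁ : Real.exp ρ ≤ Real.exp ρ₁ := Real.exp_le_exp.2 (by linarith)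
  have e₂ : Real.exp ((1 + δ) * ρ₁) ≤ Real.exp (α + ε * t) := Real.exp_le_exp.2 (by linarith)
  have e₃ : Real.exp (c + (1 + δ) * ρ₁) ≤ Real.exp (α + ε * t) :=
    Real.exp_le_exp.2 (by linarith)
  have e₄ : Real.exp ρ₁ ≤ Real.exp (α + ε * t) := Real.exp_le_exp.2 (by linarith)
  have e₅ : Real.exp (-ρ) ≤ Real.exp (-α + ε * t) := Real.exp_le_exp.2 (by linarith)
  have e₆ : Real.exp (-((1 + δ) * ρ₁)) ≤ Real.exp (-ρ) := Real.exp_le_exp.2 (by linarith)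
  rw [add_comm c ρ] at hb₁
  refine ⟨a₁, b₁, a₂, b₂, fun hdet => ?_, ?_, hb₁.trans e₄, ?_, hb₂.trans e₃, hv₁.trans e₅,
    (hv₂.trans e₆).trans e₅⟩
  · have h1 := hr₀ ρ₁ (by linarith) a₁ b₁ (Or.inl ha₁.ne')
      (by rw [abs_of_pos pa₁]; exact ha₁'.trans e₁) hb₁
    have hdet' : (a₁ : ℝ) * b₂ = a₂ * b₁ := by
      exact_mod_cast sub_eq_zero.1 hdet
    have hval : (a₁ : ℝ) * |a₂ * ζ + b₂| = a₂ * |a₁ * ζ + b₁| := by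
      rw [← abs_of_pos pa₁, ← abs_of_pos pa₂, ← abs_mul, ← abs_mul, abs_of_pos pa₁,
        abs_of_pos pa₂]
      congr 1; linear_combination hdet'
    have hlt := hv₂.trans_lt h1
    have ha21 : (a₂ : ℝ) ≤ a₁ := by
      by_contra! hgt
      have k1 := mul_lt_mul_of_pos_left hlt pa₁
      have k2 := mul_le_mul_of_nonneg_right hgt.le (abs_nonneg (a₁ * ζ + b₁ : ℝ))
      linarith
    have hb21 : |(b₂ : ℝ)| ≤ |(b₁ : ℝ)| := by
      have h3 : (a₁ : ℝ) * |(b₂ : ℝ)| = a₂ * |(b₁ : ℝ)| := by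
        have := congrArg abs hdet'
        rwa [abs_mul, abs_mul, abs_of_pos pa₁, abs_of_pos pa₂] at this
      have h4 := mul_le_mul_of_nonneg_right ha21 (abs_nonneg (b₁ : ℝ))
      exact le_of_mul_le_mul_left (h3.trans_le h4) pa₁
    have h2 := hr₀ ρ₁ (by linarith) a₂ b₂ (Or.inl ha₂.ne')
      (by rw [abs_of_pos pa₂]; exact ha21.trans (ha₁'.trans e₁)) (hb21.trans hb₁)
    linarith
  · rw [abs_of_pos pa₁]; exact ha₁'.trans (e₁.trans e₄)
  · rw [abs_of_pos pa₂]; exact ha₂'.trans e₂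

/-- The coefficient vector of the product of the linear polynomial `a T + b` and the quadratic
polynomial with coefficient vector `p`. -/
def linMul (a b : ℤ) (p : Fin 3 → ℤ) : Fin 4 → ℤ :=
  ![b * p 0, a * p 0 + b * p 1, a * p 1 + b * p 2, a * p 2]

/-- The value at `ζ` of the cubic polynomial with coefficient vector `v`. -/
noncomputable def cubEval (ζ : ℝ) (v : Fin 4 → ℤ) : ℝ :=
  v 0 + v 1 * ζ + v 2 * ζ ^ 2 + v 3 * ζ ^ 3

/-- The generalised cross product of three vectors of length four. -/
def cof4 (u v w : Fin 4 → ℤ) : Fin 4 → ℤ :=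
  ![u 1 * (v 2 * w 3 - v 3 * w 2) - v 1 * (u 2 * w 3 - u 3 * w 2) + w 1 * (u 2 * v 3 - u 3 * v 2),
    -(u 0 * (v 2 * w 3 - v 3 * w 2) - v 0 * (u 2 * w 3 - u 3 * w 2)
      + w 0 * (u 2 * v 3 - u 3 * v 2)),
    u 0 * (v 1 * w 3 - v 3 * w 1) - v 0 * (u 1 * w 3 - u 3 * w 1) + w 0 * (u 1 * v 3 - u 3 * v 1),
    -(u 0 * (v 1 * w 2 - v 2 * w 1) - v 0 * (u 1 * w 2 - u 2 * w 1)
      + w 0 * (u 1 * v 2 - u 2 * v 1))]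

theorem cubEval_linMul (ζ : ℝ) (a b : ℤ) (p : Fin 3 → ℤ) :
    cubEval ζ (linMul a b p) = (a * ζ + b) * quadEval ζ p := by
  simp [cubEval, linMul, quadEval]; ring

theorem abs_linMul_le {a b : ℤ} {p : Fin 3 → ℤ} {A B : ℝ} (ha : |(a : ℝ)| ≤ A)
    (hb : |(b : ℝ)| ≤ A) (hp : ∀ i, |(p i : ℝ)| ≤ B) (i : Fin 4) :
    |(linMul a b p i : ℝ)| ≤ 2 * (A * B) := by
  have hA := (abs_nonneg _).trans ha
  have hB := (abs_nonneg _).trans (hp 0)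
  have hAB : 0 ≤ A * B := mul_nonneg hA hB
  have h : ∀ {c d : ℝ}, |c| ≤ A → |d| ≤ B → |c * d| ≤ A * B := fun hc hd => by
    rw [abs_mul]; exact mul_le_mul hc hd (abs_nonneg _) hA
  fin_cases i <;> simp [linMul]
  · rw [← abs_mul]; linarith [h hb (hp 0)]
  · linarith [h ha (hp 0), h hb (hp 1), abs_add_le (a * p 0 : ℝ) (b * p 1)]
  · linarith [h ha (hp 1), h hb (hp 2), abs_add_le (a * p 1 : ℝ) (b * p 2)]
  · rw [← abs_mul]; linarith [h ha (hp 2)]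

theorem dotProduct_cof4_self_left (u v w : Fin 4 → ℤ) : u ⬝ᵥ cof4 u v w = 0 := by
  simp [dotProduct, Fin.sum_univ_four, cof4]; ring

theorem dotProduct_cof4_self_middle (u v w : Fin 4 → ℤ) : v ⬝ᵥ cof4 u v w = 0 := by
  simp [dotProduct, Fin.sum_univ_four, cof4]; ring

theorem dotProduct_cof4_self_right (u v w : Fin 4 → ℤ) : w ⬝ᵥ cof4 u v w = 0 := by
  simp [dotProduct, Fin.sum_univ_four, cof4]; ring

theorem linMul_dotProduct_cof4_same (a₁ b₁ a₂ b₂ a₃ b₃ : ℤ) (p : Fin 3 → ℤ) (w : Fin 4 → ℤ) :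
    linMul a₁ b₁ p ⬝ᵥ cof4 (linMul a₂ b₂ p) (linMul a₃ b₃ p) w = 0 := by
  simp [dotProduct, Fin.sum_univ_four, cof4, linMul]; ring

theorem linMul_dotProduct_cof4 (a₁ b₁ a₂ b₂ a₃ b₃ a₄ b₄ : ℤ) (p q : Fin 3 → ℤ) :
    linMul a₁ b₁ p ⬝ᵥ cof4 (linMul a₃ b₃ q) (linMul a₄ b₄ q) (linMul a₂ b₂ p)
      = (a₂ * b₁ - a₁ * b₂) * (a₃ * b₄ - a₄ * b₃) * symDet (p ⨯₃ q) := by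
  simp [dotProduct, Fin.sum_univ_four, cof4, linMul, symDet, cross_apply]; ring

theorem dotProduct_eq_cubEval (ζ : ℝ) (q z : Fin 4 → ℤ) :
    ((q ⬝ᵥ z : ℤ) : ℝ) = z 0 * cubEval ζ q - (q 1 * (ζ * z 0 - z 1) + q 2 * (ζ ^ 2 * z 0 - z 2)
      + q 3 * (ζ ^ 3 * z 0 - z 3)) := by
  simp [dotProduct, Fin.sum_univ_four, cubEval]; ring

theorem abs_dotProduct_le {ζ : ℝ} {q z : Fin 4 → ℤ} {H v Z L : ℝ} (hq : ∀ i, |(q i : ℝ)| ≤ H)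
    (hv : |cubEval ζ q| ≤ v) (hz : |(z 0 : ℝ)| ≤ Z)
    (hL : ∀ t : Fin 3, |ζ ^ ((t : ℕ) + 1) * z 0 - z t.succ| ≤ L) :
    |((q ⬝ᵥ z : ℤ) : ℝ)| ≤ Z * v + 3 * (H * L) := by
  have hZ := (abs_nonneg _).trans hz
  have hH := (abs_nonneg _).trans (hq 0)
  have l0 := hL 0
  have l1 := hL 1
  have l2 := hL 2
  simp at l0 l1 l2
  rw [dotProduct_eq_cubEval ζ]
  have h : ∀ {c d : ℝ}, |c| ≤ H → |d| ≤ L → |c * d| ≤ H * L := fun hc hd => by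
    rw [abs_mul]; exact mul_le_mul hc hd (abs_nonneg _) hH
  have h0 : |z 0 * cubEval ζ q| ≤ Z * v := by
    rw [abs_mul]; exact mul_le_mul hz hv (abs_nonneg _) hZ
  have h1 := h (hq 1) l0
  have h2 := h (hq 2) l1
  have h3 := h (hq 3) l2
  refine (abs_sub _ _).trans ?_
  refine (add_le_add h0 (abs_add_three _ _ _)).trans ?_
  linarith

theorem abs_det_expansion_le {x y z a b c X Y Z : ℝ} (hx : |x| ≤ X) (hy : |y| ≤ Y) (hz : |z| ≤ Z)
    {A B C : ℝ} (ha : |a| ≤ A) (hb : |b| ≤ B) (hc : |c| ≤ C) :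
    |x * a - y * b + z * c| ≤ X * A + Y * B + Z * C := by
  have h : ∀ {c d C D : ℝ}, |c| ≤ C → |d| ≤ D → |c * d| ≤ C * D := fun hc hd => by
    rw [abs_mul]; exact mul_le_mul hc hd (abs_nonneg _) ((abs_nonneg _).trans hc)
  linarith [abs_add_le (x * a - y * b) (z * c), abs_sub (x * a) (y * b), h hx ha, h hy hb, h hz hc]

section cofactors

variable {ζ : ℝ} {u v w : Fin 4 → ℤ} {U V W : ℝ}

theorem abs_cof4_zero_le (hu : ∀ i, |(u i : ℝ)| ≤ U) (hv : ∀ i, |(v i : ℝ)| ≤ V)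
    (hw : ∀ i, |(w i : ℝ)| ≤ W) : |(cof4 u v w 0 : ℝ)| ≤ 6 * (U * V * W) := by
  have := abs_det_expansion_le (hu 1) (hv 1) (hw 1)
    (abs_mul_sub_mul_le (hv 2) (hw 3) (hv 3) (hw 2))
    (abs_mul_sub_mul_le (hu 2) (hw 3) (hu 3) (hw 2))
    (abs_mul_sub_mul_le (hu 2) (hv 3) (hu 3) (hv 2))
  simp only [cof4, Matrix.cons_val_zero]
  push_cast
  linarith

theorem abs_cof4_sub_le {a b c : ℝ} (hu : ∀ i, |(u i : ℝ)| ≤ U) (hv : ∀ i, |(v i : ℝ)| ≤ V)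
    (hw : ∀ i, |(w i : ℝ)| ≤ W) (ha : |cubEval ζ u| ≤ a) (hb : |cubEval ζ v| ≤ b)
    (hc : |cubEval ζ w| ≤ c) (t : Fin 3) :
    |ζ ^ ((t : ℕ) + 1) * cof4 u v w 0 - cof4 u v w t.succ|
      ≤ 2 * (a * (V * W) + b * (U * W) + c * (U * V)) := by
  have key : ∀ i j : Fin 4, |cubEval ζ u * (v i * w j - v j * w i)
      - cubEval ζ v * (u i * w j - u j * w i) + cubEval ζ w * (u i * v j - u j * v i)|
      ≤ 2 * (a * (V * W) + b * (U * W) + c * (U * V)) := fun i j => by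
    have := abs_det_expansion_le ha hb hc
      (abs_mul_sub_mul_le (hv i) (hw j) (hv j) (hw i))
      (abs_mul_sub_mul_le (hu i) (hw j) (hu j) (hw i))
      (abs_mul_sub_mul_le (hu i) (hv j) (hu j) (hv i))
    linarith
  fin_cases t
  · convert key 2 3 using 2
    simp [cof4, cubEval]; ring
  · rw [← abs_neg]
    convert key 1 3 using 2
    simp [cof4, cubEval]; ring
  · convert key 1 2 using 2
    simp [cof4, cubEval]; ring

end cofactors

theorem linearIndependent_of_dotProduct {ι κ : Type*} [Fintype ι] [Fintype κ] {z u : ι → κ → ℤ}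
    (h0 : ∀ i j, i ≠ j → u i ⬝ᵥ z j = 0) (h1 : ∀ i, u i ⬝ᵥ z i ≠ 0) : LinearIndependent ℤ z := by
  rw [Fintype.linearIndependent_iff]
  intro g hg i
  have h := congrArg (fun x => u i ⬝ᵥ x) hg
  simp only [dotProduct_sum, dotProduct_smul, dotProduct_zero] at h
  rw [Finset.sum_eq_single i (fun j _ hj => by rw [h0 i j hj.symm, smul_zero]) (by simp)] at h
  exact (mul_eq_zero.1 h).resolve_right (h1 i)

theorem not_linearIndependent_of_dotProduct_eq_zero {v : Fin 3 → Fin 4 → ℤ}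
    {z₁ z₂ u₁ u₂ : Fin 4 → ℤ} (hv₁ : ∀ i, v i ⬝ᵥ z₁ = 0) (hv₂ : ∀ i, v i ⬝ᵥ z₂ = 0)
    (h₁₁ : u₁ ⬝ᵥ z₁ ≠ 0) (h₁₂ : u₁ ⬝ᵥ z₂ = 0) (h₂₁ : u₂ ⬝ᵥ z₁ = 0) (h₂₂ : u₂ ⬝ᵥ z₂ ≠ 0) :
    ¬ LinearIndependent ℤ v := by
  intro hv
  have hall : LinearIndependent ℤ (Sum.elim v ![u₁, u₂]) := by
    rw [Fintype.linearIndependent_iff] at hv ⊢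
    intro g hg
    simp only [Fintype.sum_sum_type, Sum.elim_inl, Sum.elim_inr, Fin.sum_univ_two,
      Matrix.cons_val_zero, Matrix.cons_val_one] at hg
    have e₁ := congrArg (fun x => x ⬝ᵥ z₁) hg
    have e₂ := congrArg (fun x => x ⬝ᵥ z₂) hg
    simp only [add_dotProduct, sum_dotProduct, smul_dotProduct, hv₁, hv₂, h₁₂, h₂₁,
      Finset.sum_const_zero, zero_add, add_zero, zero_dotProduct, smul_eq_mul, mul_zero, mul_eq_zero,
      h₁₁, h₂₂, or_false] at e₁ e₂
    rw [e₁, e₂] at hg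
    simp only [zero_smul, add_zero] at hg
    have := hv _ hg
    rintro (i | i)
    · exact this i
    · fin_cases i
      · exact e₁
      · exact e₂
  have := hall.fintype_card_le_finrank
  simp at this

theorem symDet_cross_comm (p q : Fin 3 → ℤ) : symDet (q ⨯₃ p) = symDet (p ⨯₃ q) := by
  simp [symDet, cross_apply]; ring

theorem linMul_dual_vectors {a b : Fin 6 → ℤ} {p q : Fin 3 → ℤ} (hD : symDet (p ⨯₃ q) ≠ 0)
    (h₀ : a 0 * b 1 - a 1 * b 0 ≠ 0) (h₁ : a 2 * b 3 - a 3 * b 2 ≠ 0)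
    (h₂ : a 4 * b 5 - a 5 * b 4 ≠ 0) :
    let u : Fin 4 → Fin 4 → ℤ := ![linMul (a 0) (b 0) p, linMul (a 1) (b 1) p,
      linMul (a 2) (b 2) q, linMul (a 3) (b 3) q]
    let z : Fin 4 → Fin 4 → ℤ := ![
      cof4 (linMul (a 2) (b 2) q) (linMul (a 3) (b 3) q) (linMul (a 1) (b 1) p),
      cof4 (linMul (a 2) (b 2) q) (linMul (a 3) (b 3) q) (linMul (a 0) (b 0) p),
      cof4 (linMul (a 4) (b 4) p) (linMul (a 5) (b 5) p) (linMul (a 3) (b 3) q),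
      cof4 (linMul (a 4) (b 4) p) (linMul (a 5) (b 5) p) (linMul (a 2) (b 2) q)]
    (∀ i j, i ≠ j → u i ⬝ᵥ z j = 0) ∧ ∀ i, u i ⬝ᵥ z i ≠ 0 := by
  intro u z
  have hD' : symDet (q ⨯₃ p) ≠ 0 := by rwa [symDet_cross_comm]
  have h₀' : a 1 * b 0 - a 0 * b 1 ≠ 0 := by rwa [← neg_ne_zero, neg_sub]
  have h₁' : a 3 * b 2 - a 2 * b 3 ≠ 0 := by rwa [← neg_ne_zero, neg_sub]
  constructor
  · intro i j hij
    fin_cases i <;> fin_cases j <;> first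
      | exact absurd rfl hij
      | simp only [u, z, Fin.zero_eta, Fin.mk_one, Fin.reduceFinMk, Matrix.cons_val,
          dotProduct_cof4_self_left, dotProduct_cof4_self_middle, dotProduct_cof4_self_right,
          linMul_dotProduct_cof4_same]
  · intro i
    fin_cases i <;> simp only [u, z, Fin.zero_eta, Fin.mk_one, Fin.reduceFinMk,
      Matrix.cons_val, linMul_dotProduct_cof4] <;>
      exact mul_ne_zero (mul_ne_zero (by assumption) (by assumption)) (by assumption)

theorem cof4_linMul_bounds {ζ H A B h h' v : ℝ} {a b : ℤ} {p q : Fin 3 → ℤ}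
    (hq : ∀ i, |(q i : ℝ)| ≤ H) (hp : ∀ i, |(p i : ℝ)| ≤ B) (ha : |(a : ℝ)| ≤ A)
    (hb : |(b : ℝ)| ≤ A) (hqv : |quadEval ζ q| ≤ h) (hpv : |quadEval ζ p| ≤ h')
    (hv : |a * ζ + b| ≤ v) :
    |(cof4 (linMul 0 1 q) (linMul 1 0 q) (linMul a b p) 0 : ℝ)| ≤ 48 * (H * H * (A * B)) ∧
    ∀ t : Fin 3, |ζ ^ ((t : ℕ) + 1) * cof4 (linMul 0 1 q) (linMul 1 0 q) (linMul a b p) 0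
        - cof4 (linMul 0 1 q) (linMul 1 0 q) (linMul a b p) t.succ|
      ≤ 16 * (1 + |ζ|) * (h * (H * (A * B)) + v * h' * (H * H)) := by
  have k0 : ∀ i, |(linMul 0 1 q i : ℝ)| ≤ 2 * (1 * H) :=
    abs_linMul_le (by simp) (by simp) hq
  have k1 : ∀ i, |(linMul 1 0 q i : ℝ)| ≤ 2 * (1 * H) :=
    abs_linMul_le (by simp) (by simp) hq
  have k2 := abs_linMul_le ha hb hp
  have hH := (abs_nonneg _).trans (hq 0)
  have hB := (abs_nonneg _).trans (hp 0)
  have hA := (abs_nonneg _).trans ha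
  have hh := (abs_nonneg _).trans hqv
  have hh' := (abs_nonneg _).trans hpv
  have hv0 := (abs_nonneg _).trans hv
  have hζ := abs_nonneg ζ
  constructor
  · have := abs_cof4_zero_le k0 k1 k2
    linarith
  · intro t
    have e0 : |cubEval ζ (linMul 0 1 q)| ≤ (1 + |ζ|) * h := by
      rw [cubEval_linMul]; simp; nlinarith
    have e1 : |cubEval ζ (linMul 1 0 q)| ≤ (1 + |ζ|) * h := by
      rw [cubEval_linMul]; simp; nlinarith
    have e2 : |cubEval ζ (linMul a b p)| ≤ v * h' := by
      rw [cubEval_linMul, abs_mul]; exact mul_le_mul hv hpv (abs_nonneg _) hv0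
    refine (abs_cof4_sub_le k0 k1 k2 e0 e1 e2 t).trans ?_
    have : 0 ≤ v * h' * (H * H) := by positivity
    have : 0 ≤ |ζ| * (v * h' * (H * H)) := by positivity
    linarith

theorem exists_le_exp_mul (K : ℝ) {ε : ℝ} (hε : 0 < ε) :
    ∃ t₀ : ℝ, ∀ t, t₀ ≤ t → K ≤ Real.exp (ε * t) := by
  refine ⟨K / ε, fun t ht => ?_⟩
  rw [div_le_iff₀ hε] at ht
  linarith [Real.add_one_le_exp (ε * t)]

theorem mul_exp_le_exp {K x y z : ℝ} (hK : K ≤ Real.exp z) (h : z + x ≤ y) :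
    K * Real.exp x ≤ Real.exp y := by
  refine (mul_le_mul_of_nonneg_right hK (Real.exp_pos x).le).trans ?_
  rw [← Real.exp_add]; exact Real.exp_le_exp.2 h

/-- Four independent cubic polynomials with small values at an extremal number. -/
theorem IsExtremal.exists_cubic_quadruple {ζ : ℝ} (hζ : IsExtremal ζ) {κ : ℝ} (hκ : 0 < κ)
    (hκ1 : κ ≤ 1) :
    ∃ s₀ : ℝ, ∀ s, s₀ ≤ s → ∃ v : Fin 4 → Fin 4 → ℤ, LinearIndependent ℤ v ∧ ∀ i,
      (∀ k, |(v i k : ℝ)| ≤ Real.exp s) ∧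
      |cubEval ζ (v i)| ≤ Real.exp (-((2 * Real.goldenRatio - 1 - κ) * s)) := by
  obtain ⟨g1, g2⟩ := goldenRatio_bounds
  have hg := Real.goldenRatio_sq
  set g := Real.goldenRatio with hgdef
  obtain ⟨ε, hε, hεκ⟩ : ∃ ε : ℝ, 0 < ε ∧ 100 * ε = κ := ⟨κ / 100, by positivity, by ring⟩
  obtain ⟨s₁, hs₁⟩ := hζ.exists_pairs hε
  obtain ⟨t₁, ht₁⟩ := hζ.exists_linear_pair hε
  obtain ⟨t₂, ht₂⟩ := exists_le_exp_mul 2 hε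
  refine ⟨max (max 0 (2 * s₁)) (max (3 * t₁) (3 * t₂)), fun s hs => ?_⟩
  have hsa : 0 ≤ s := ((le_max_left _ _).trans (le_max_left _ _)).trans hs
  have hsb : 2 * s₁ ≤ s := ((le_max_right _ _).trans (le_max_left _ _)).trans hs
  have hsc : 3 * t₁ ≤ s := ((le_max_left _ _).trans (le_max_right _ _)).trans hs
  have hsd : 3 * t₂ ≤ s := ((le_max_right _ _).trans (le_max_right _ _)).trans hs
  have hεs : ε * s ≤ 1 / 100 * s := mul_le_mul_of_nonneg_right (by linarith) hsa
  obtain ⟨t, P, Q, ht, hD, hP, hQ, hPv, hQv, l1, l2⟩ := hs₁ ((1 - 4 * ε) * s) (by linarith)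
  have hεt : ε * t ≤ 1 / 100 * t := mul_le_mul_of_nonneg_right (by linarith) ht
  have hεt0 : 0 ≤ ε * t := by positivity
  have hεs0 : 0 ≤ ε * s := by positivity
  have gt1 : 1.618 * t ≤ g * t := by gcongr
  have gt2 : g * t ≤ 1.6181 * t := by gcongr
  have hst : s ≤ 3 * t := by linarith
  have hts : 1.6 * t ≤ s := by linarith
  have hεts := mul_le_mul_of_nonneg_left hst hε.le
  have hεst := mul_le_mul_of_nonneg_left hts hε.le
  have h2 := ht₂ t (by linarith)
  obtain ⟨a₁, b₁, a₂, b₂, d₁₂, ha₁, hb₁, ha₂, hb₂, hv₁, hv₂⟩ :=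
    ht₁ t (by linarith) (s - t - 2 * (ε * t)) (by linarith) (by linarith)
  obtain ⟨a₃, b₃, a₄, b₄, d₃₄, ha₃, hb₃, ha₄, hb₄, hv₃, hv₄⟩ :=
    ht₁ t (by linarith) (s - (g + ε) * t - 2 * (ε * t)) (by linarith) (by linarith)
  have hdual := linMul_dual_vectors (a := ![a₁, a₂, a₃, a₄, a₁, a₂])
    (b := ![b₁, b₂, b₃, b₄, b₁, b₂]) hD d₁₂ d₃₄ d₁₂
  have vb : ∀ {x y : ℝ}, |x| ≤ Real.exp (-(s - t - 2 * (ε * t)) + ε * t) →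
      |y| ≤ Real.exp (-((2 * g + 1 - ε) * t)) →
      |x * y| ≤ Real.exp (-((2 * g - 1 - κ) * s)) := fun hx hy => by
    rw [abs_mul]
    refine (mul_le_mul hx hy (abs_nonneg _) (Real.exp_pos _).le).trans ?_
    rw [← Real.exp_add, Real.exp_le_exp]
    have e1 : s ≤ (g + 1) * t + 13 * (ε * t) := by linarith
    have e2 := mul_le_mul_of_nonneg_left e1 (by linarith : 0 ≤ 2 * g - 2)
    have e3 : (2 * g - 2) * ((g + 1) * t + 13 * (ε * t))
      = 2 * g * t + (2 * g - 2) * (13 * (ε * t)) := by linear_combination 2 * t * hg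
    have e4 : (2 * g - 2) * (13 * (ε * t)) ≤ 1.24 * (13 * (ε * t)) := by gcongr; linarith
    have e5 : κ * s = 100 * (ε * s) := by rw [← hεκ]; ring
    linarith
  have wb : ∀ {x y : ℝ}, |x| ≤ Real.exp (-(s - (g + ε) * t - 2 * (ε * t)) + ε * t) →
      |y| ≤ Real.exp (-((3 * g + 2 - ε) * t)) →
      |x * y| ≤ Real.exp (-((2 * g - 1 - κ) * s)) := fun hx hy => by
    rw [abs_mul]
    refine (mul_le_mul hx hy (abs_nonneg _) (Real.exp_pos _).le).trans ?_
    rw [← Real.exp_add, Real.exp_le_exp]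
    have e1 : s ≤ (g + 1) * t + 13 * (ε * t) := by linarith
    have e2 := mul_le_mul_of_nonneg_left e1 (by linarith : 0 ≤ 2 * g - 2)
    have e3 : (2 * g - 2) * ((g + 1) * t + 13 * (ε * t))
      = 2 * g * t + (2 * g - 2) * (13 * (ε * t)) := by linear_combination 2 * t * hg
    have e4 : (2 * g - 2) * (13 * (ε * t)) ≤ 1.24 * (13 * (ε * t)) := by gcongr; linarith
    have e5 : κ * s = 100 * (ε * s) := by rw [← hεκ]; ring
    linarith
  have hp : ∀ {a b : ℤ}, |(a : ℝ)| ≤ Real.exp (s - t - 2 * (ε * t) + ε * t) →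
      |(b : ℝ)| ≤ Real.exp (s - t - 2 * (ε * t) + ε * t) →
      ∀ k, |(linMul a b P k : ℝ)| ≤ Real.exp s := fun ha hb k => by
    refine (abs_linMul_le ha hb hP k).trans ?_
    rw [← Real.exp_add]
    exact mul_exp_le_exp h2 (by linarith)
  have hq : ∀ {a b : ℤ}, |(a : ℝ)| ≤ Real.exp (s - (g + ε) * t - 2 * (ε * t) + ε * t) →
      |(b : ℝ)| ≤ Real.exp (s - (g + ε) * t - 2 * (ε * t) + ε * t) →
      ∀ k, |(linMul a b Q k : ℝ)| ≤ Real.exp s := fun ha hb k => by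
    refine (abs_linMul_le ha hb hQ k).trans ?_
    rw [← Real.exp_add]
    exact mul_exp_le_exp h2 (by linarith)
  refine ⟨![linMul a₁ b₁ P, linMul a₂ b₂ P, linMul a₃ b₃ Q, linMul a₄ b₄ Q],
    linearIndependent_of_dotProduct (fun i j hij => (dotProduct_comm _ _).trans
      (hdual.1 j i hij.symm)) (fun i => (dotProduct_comm _ _).trans_ne (hdual.2 i)), fun i => ?_⟩
  fin_cases i
  · exact ⟨hp ha₁ hb₁, (cubEval_linMul ζ _ _ _).symm ▸ vb hv₁ hPv⟩
  · exact ⟨hp ha₂ hb₂, (cubEval_linMul ζ _ _ _).symm ▸ vb hv₂ hPv⟩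
  · exact ⟨hq ha₃ hb₃, (cubEval_linMul ζ _ _ _).symm ▸ wb hv₃ hQv⟩
  · exact ⟨hq ha₄ hb₄, (cubEval_linMul ζ _ _ _).symm ▸ wb hv₄ hQv⟩

/-- No three independent cubic polynomials have smaller values at an extremal number. -/
theorem IsExtremal.not_exists_cubic_triple {ζ : ℝ} (hζ : IsExtremal ζ) {κ : ℝ} (hκ : 0 < κ)
    (hκ1 : κ ≤ 1) (s₀ : ℝ) :
    ∃ s, s₀ ≤ s ∧ ∀ v : Fin 3 → Fin 4 → ℤ, (∀ i, (∀ k, |(v i k : ℝ)| ≤ Real.exp s) ∧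
      |cubEval ζ (v i)| ≤ Real.exp (-((2 * Real.goldenRatio - 1 + κ) * s))) →
      ¬ LinearIndependent ℤ v := by
  obtain ⟨g1, g2⟩ := goldenRatio_bounds
  have hg := Real.goldenRatio_sq
  set g := Real.goldenRatio with hgdef
  obtain ⟨ε, hε, hεκ⟩ : ∃ ε : ℝ, 0 < ε ∧ 100 * ε = κ := ⟨κ / 100, by positivity, by ring⟩
  obtain ⟨s₁, hs₁⟩ := hζ.exists_pairs hε
  obtain ⟨t₁, ht₁⟩ := hζ.exists_linear_pair hε
  obtain ⟨t₂, ht₂⟩ := exists_le_exp_mul (200 * (1 + |ζ|)) hε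
  set σ := max (max (3 * |s₀|) s₁) (max (3 * t₁) (3 * t₂)) with hσ
  have hsa : 3 * |s₀| ≤ σ := (le_max_left _ _).trans (le_max_left _ _)
  have hsb : s₁ ≤ σ := (le_max_right _ _).trans (le_max_left _ _)
  have hsc : 3 * t₁ ≤ σ := (le_max_left _ _).trans (le_max_right _ _)
  have hsd : 3 * t₂ ≤ σ := (le_max_right _ _).trans (le_max_right _ _)
  obtain ⟨t, P, Q, ht, hD, hP, hQ, hPv, hQv, l1, l2⟩ := hs₁ σ hsb
  have hεt : ε * t ≤ 1 / 100 * t := mul_le_mul_of_nonneg_right (by linarith) ht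
  have hεt0 : 0 ≤ ε * t := by positivity
  have gt1 : 1.618 * t ≤ g * t := by gcongr
  have gt2 : g * t ≤ 1.6181 * t := by gcongr
  have hσt : σ ≤ 3 * t := by linarith
  have hM := ht₂ t (by linarith)
  have hM1 : 1 ≤ 1 + |ζ| := by linarith [abs_nonneg ζ]
  set M := 1 + |ζ| with hMdef
  have hM2 : M * Real.exp (-(ε * t)) ≤ 1 / 200 := by
    rw [Real.exp_neg, ← div_eq_mul_inv, div_le_iff₀ (Real.exp_pos _)]; linarith
  obtain ⟨a₁, b₁, a₂, b₂, d₁₂, ha₁, hb₁, ha₂, hb₂, hv₁, hv₂⟩ :=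
    ht₁ t (by linarith) (g * t - 4 * (ε * t)) (by linarith) (by linarith)
  set s := (g + 1) * t - 10 * (ε * t) with hs
  have hst : 2.4 * t ≤ s := by linarith
  refine ⟨s, by linarith [le_abs_self s₀], fun v hv => ?_⟩
  have hε1 : Real.exp (-(ε * t)) ≤ M * Real.exp (-(ε * t)) :=
    le_mul_of_one_le_left (Real.exp_pos _).le hM1
  have orth : ∀ {a b : ℤ}, |(a : ℝ)| ≤ Real.exp (g * t - 4 * (ε * t) + ε * t) →
      |(b : ℝ)| ≤ Real.exp (g * t - 4 * (ε * t) + ε * t) →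
      |a * ζ + b| ≤ Real.exp (-(g * t - 4 * (ε * t)) + ε * t) → ∀ i,
      v i ⬝ᵥ cof4 (linMul 0 1 Q) (linMul 1 0 Q) (linMul a b P) = 0 := by
    intro a b ha hb hab i
    obtain ⟨c1, c2⟩ := cof4_linMul_bounds hQ hP ha hb hQv hPv hab
    have c3 := abs_dotProduct_le (hv i).1 (hv i).2 c1 c2
    by_contra hne
    have c4 := one_le_abs_cast hne
    simp only [← Real.exp_add] at c3
    have m1 : 48 * Real.exp ((g + ε) * t + (g + ε) * t + (g * t - 4 * (ε * t) + ε * t + t))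
        * Real.exp (-((2 * g - 1 + κ) * s)) ≤ 48 * Real.exp (-(ε * t)) := by
      rw [mul_assoc, ← Real.exp_add]
      gcongr
      have e1 : (2 * g - 1) * s = (3 * g + 1) * t - (2 * g - 1) * (10 * (ε * t)) := by
        rw [hs]; linear_combination 2 * t * hg
      have e2 : (2 * g - 1) * (10 * (ε * t)) ≤ 2.24 * (10 * (ε * t)) := by gcongr; linarith
      have e3 : κ * s = 100 * (ε * s) := by rw [← hεκ]; ring
      have e4 := mul_le_mul_of_nonneg_left hst hε.le
      linarith
    have m2 : Real.exp s * Real.exp (-((3 * g + 2 - ε) * t)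
          + ((g + ε) * t + (g * t - 4 * (ε * t) + ε * t + t))) ≤ Real.exp (-(ε * t)) := by
      rw [← Real.exp_add, Real.exp_le_exp, hs]; linarith
    have m3 : Real.exp s * Real.exp (-(g * t - 4 * (ε * t)) + ε * t + -((2 * g + 1 - ε) * t)
          + ((g + ε) * t + (g + ε) * t)) ≤ Real.exp (-(ε * t)) := by
      rw [← Real.exp_add, Real.exp_le_exp, hs]; linarith
    have m4 := mul_le_mul_of_nonneg_left (add_le_add m2 m3) (by linarith : 0 ≤ M)
    linarith
  have hQP : ((0 : ℤ) * 0 - 1 * 1) ≠ 0 := by norm_num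
  refine not_linearIndependent_of_dotProduct_eq_zero (orth ha₁ hb₁ hv₁) (orth ha₂ hb₂ hv₂)
    (u₁ := linMul a₂ b₂ P) (u₂ := linMul a₁ b₁ P) ?_ (dotProduct_cof4_self_right _ _ _)
    (dotProduct_cof4_self_right _ _ _) ?_
  · rw [linMul_dotProduct_cof4]
    exact mul_ne_zero (mul_ne_zero d₁₂ hQP) hD
  · rw [linMul_dotProduct_cof4]
    exact mul_ne_zero (mul_ne_zero (by rwa [← neg_ne_zero, neg_sub]) hQP) hD

/-- Four independent simultaneous approximations to the powers of an extremal number. -/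
theorem IsExtremal.exists_approx_quadruple {ζ : ℝ} (hζ : IsExtremal ζ) {κ : ℝ} (hκ : 0 < κ)
    (hκ1 : κ ≤ 1) :
    ∃ y₀ : ℝ, ∀ y, y₀ ≤ y → ∃ v : Fin 4 → Fin 4 → ℤ, LinearIndependent ℤ v ∧ ∀ i,
      |(v i 0 : ℝ)| ≤ Real.exp y ∧ ∀ k : Fin 3, |ζ ^ ((k : ℕ) + 1) * v i 0 - v i k.succ|
        ≤ Real.exp (-((2 * Real.goldenRatio - 3 - κ) * y)) := by
  obtain ⟨g1, g2⟩ := goldenRatio_bounds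
  have hg := Real.goldenRatio_sq
  set g := Real.goldenRatio with hgdef
  obtain ⟨ε, hε, hεκ⟩ : ∃ ε : ℝ, 0 < ε ∧ 100 * ε = κ := ⟨κ / 100, by positivity, by ring⟩
  have hM1 : 1 ≤ 1 + |ζ| := by linarith [abs_nonneg ζ]
  set M := 1 + |ζ| with hMdef
  obtain ⟨s₁, hs₁⟩ := hζ.exists_pairs hε
  obtain ⟨t₁, ht₁⟩ := hζ.exists_linear_pair hε
  obtain ⟨t₂, ht₂⟩ := exists_le_exp_mul (48 + 32 * (M * M)) hε
  refine ⟨max (max 0 (3 * s₁)) (max (8 * t₁) (8 * t₂)), fun y hy => ?_⟩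
  have hya : 0 ≤ y := ((le_max_left _ _).trans (le_max_left _ _)).trans hy
  have hyb : 3 * s₁ ≤ y := ((le_max_right _ _).trans (le_max_left _ _)).trans hy
  have hyc : 8 * t₁ ≤ y := ((le_max_left _ _).trans (le_max_right _ _)).trans hy
  have hyd : 8 * t₂ ≤ y := ((le_max_right _ _).trans (le_max_right _ _)).trans hy
  have hεy : ε * y ≤ 1 / 100 * y := mul_le_mul_of_nonneg_right (by linarith) hya
  have hεy0 : 0 ≤ ε * y := by positivity
  have hsy : 1 / 3 * y ≤ (2 - g) * (y - 4 * (ε * y)) := by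
    have := mul_le_mul (by linarith : 0.38 ≤ 2 - g) (by linarith : 0.96 * y ≤ y - 4 * (ε * y))
      (by positivity) (by linarith)
    linarith
  obtain ⟨t, P, Q, ht, hD, hP, hQ, hPv, hQv, l1, l2⟩ :=
    hs₁ ((2 - g) * (y - 4 * (ε * y))) (by linarith)
  have hεt : ε * t ≤ 1 / 100 * t := mul_le_mul_of_nonneg_right (by linarith) ht
  have hεt0 : 0 ≤ ε * t := by positivity
  have gt1 : 1.618 * t ≤ g * t := by gcongr
  have gt2 : g * t ≤ 1.6181 * t := by gcongr
  have gε : g * (ε * t) ≤ 1.6181 * (ε * t) := by gcongr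
  have l3 : (2 * g + 1) * t - (g + 1) * (ε * t) ≤ y - 4 * (ε * y) := by
    have := mul_le_mul_of_nonneg_left l1 (by linarith : 0 ≤ g + 1)
    linear_combination this - (y - 4 * (ε * y) + t) * hg
  have l4 : y - 4 * (ε * y) ≤ (3 * g + 2) * t + (g + 1) * (ε * t) := by
    have := mul_le_mul_of_nonneg_left l2 (by linarith : 0 ≤ g + 1)
    linear_combination this + (t + (y - 4 * (ε * y))) * hg
  have hty : 4 * t ≤ y := by linarith
  have hyt : y ≤ 8 * t := by linarith
  have e1 := mul_le_mul_of_nonneg_left hty hε.le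
  have e2 := mul_le_mul_of_nonneg_left hyt hε.le
  have l5 : (2 * g + 1) * t + 13 * (ε * t) ≤ y := by linarith
  have l6 : y ≤ (3 * g + 2) * t + 35 * (ε * t) := by linarith
  have hκy : κ * y = 100 * (ε * y) := by rw [← hεκ]; ring
  have hK := ht₂ t (by linarith)
  have hMM : M ≤ M * M := le_mul_of_one_le_left (by linarith) hM1
  obtain ⟨a₁, b₁, a₂, b₂, d₁₂, ha₁, hb₁, ha₂, hb₂, hv₁, hv₂⟩ :=
    ht₁ t (by linarith) (y - (2 * g + 1) * t - 4 * (ε * t)) (by linarith) (by linarith)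
  have hdual := linMul_dual_vectors (a := ![a₁, a₂, 0, 1, 0, 1])
    (b := ![b₁, b₂, 1, 0, 1, 0]) hD d₁₂
    (show (0 * 0 - 1 * 1 : ℤ) ≠ 0 by norm_num) (show (0 * 0 - 1 * 1 : ℤ) ≠ 0 by norm_num)
  have zb : ∀ {a b : ℤ}, |(a : ℝ)| ≤ Real.exp (y - (2 * g + 1) * t - 4 * (ε * t) + ε * t) →
      |(b : ℝ)| ≤ Real.exp (y - (2 * g + 1) * t - 4 * (ε * t) + ε * t) →
      |a * ζ + b| ≤ Real.exp (-(y - (2 * g + 1) * t - 4 * (ε * t)) + ε * t) →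
      |(cof4 (linMul 0 1 Q) (linMul 1 0 Q) (linMul a b P) 0 : ℝ)| ≤ Real.exp y ∧
      ∀ k : Fin 3, |ζ ^ ((k : ℕ) + 1) * cof4 (linMul 0 1 Q) (linMul 1 0 Q) (linMul a b P) 0
        - cof4 (linMul 0 1 Q) (linMul 1 0 Q) (linMul a b P) k.succ|
        ≤ Real.exp (-((2 * g - 3 - κ) * y)) := by
    intro a b ha hb hab
    obtain ⟨c1, c2⟩ := cof4_linMul_bounds hQ hP ha hb hQv hPv hab
    simp only [← Real.exp_add] at c1 c2
    refine ⟨c1.trans (mul_exp_le_exp (z := ε * t) (by linarith) (by linarith)), fun k =>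
      (c2 k).trans ?_⟩
    have f1 := mul_le_mul_of_nonneg_left l6 (by linarith : 0 ≤ 2 * g - 2)
    have f2 : (2 * g - 2) * ((3 * g + 2) * t + 35 * (ε * t))
      = (4 * g + 2) * t + (2 * g - 2) * (35 * (ε * t)) := by linear_combination 6 * t * hg
    have f3 : (2 * g - 2) * (35 * (ε * t)) ≤ 1.24 * (35 * (ε * t)) := by gcongr; linarith
    have f4 := mul_le_mul_of_nonneg_left l5 (by linarith : 0 ≤ 4 - 2 * g)
    have f5 : (4 - 2 * g) * ((2 * g + 1) * t + 13 * (ε * t))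
      = 2 * g * t + (4 - 2 * g) * (13 * (ε * t)) := by linear_combination -4 * t * hg
    have f6 : 0 ≤ (4 - 2 * g) * (13 * (ε * t)) := mul_nonneg (by linarith) (by positivity)
    have m : 16 * M * (Real.exp (-((2 * g - 3 - κ) * y) - ε * t)
        + Real.exp (-((2 * g - 3 - κ) * y) - ε * t)) ≤ Real.exp (-((2 * g - 3 - κ) * y)) := by
      rw [← two_mul, ← mul_assoc]
      exact mul_exp_le_exp (z := ε * t) (by linarith) (by linarith)
    refine le_trans ?_ m
    gcongr
    · linarith
    · linarith
  have wb : ∀ {a b : ℤ}, |(a : ℝ)| ≤ 1 → |(b : ℝ)| ≤ 1 → |a * ζ + b| ≤ M →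
      |(cof4 (linMul 0 1 P) (linMul 1 0 P) (linMul a b Q) 0 : ℝ)| ≤ Real.exp y ∧
      ∀ k : Fin 3, |ζ ^ ((k : ℕ) + 1) * cof4 (linMul 0 1 P) (linMul 1 0 P) (linMul a b Q) 0
        - cof4 (linMul 0 1 P) (linMul 1 0 P) (linMul a b Q) k.succ|
        ≤ Real.exp (-((2 * g - 3 - κ) * y)) := by
    intro a b ha hb hab
    obtain ⟨c1, c2⟩ := cof4_linMul_bounds hP hQ ha hb hPv hQv hab
    simp only [one_mul, mul_assoc M, ← Real.exp_add] at c1 c2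
    refine ⟨c1.trans (mul_exp_le_exp (z := ε * t) (by linarith [mul_self_nonneg M])
      (by linarith)), fun k => (c2 k).trans ?_⟩
    have f1 := mul_le_mul_of_nonneg_left l6 (by linarith : 0 ≤ 2 * g - 3)
    have f2 : (2 * g - 3) * ((3 * g + 2) * t + 35 * (ε * t))
      = g * t + (2 * g - 3) * (35 * (ε * t)) := by linear_combination 6 * t * hg
    have f3 : (2 * g - 3) * (35 * (ε * t)) ≤ 0.24 * (35 * (ε * t)) := by gcongr; linarith
    have m : 16 * M * (M * Real.exp (-((2 * g - 3 - κ) * y) - ε * t)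
        + M * Real.exp (-((2 * g - 3 - κ) * y) - ε * t))
        ≤ Real.exp (-((2 * g - 3 - κ) * y)) := by
      have : 16 * M * (M * Real.exp (-((2 * g - 3 - κ) * y) - ε * t)
        + M * Real.exp (-((2 * g - 3 - κ) * y) - ε * t))
        = 32 * (M * M) * Real.exp (-((2 * g - 3 - κ) * y) - ε * t) := by ring
      rw [this]
      exact mul_exp_le_exp (z := ε * t) (by linarith) (by linarith)
    refine le_trans ?_ m
    gcongr
    · refine le_trans ?_ (le_mul_of_one_le_left (Real.exp_pos _).le hM1)
      rw [Real.exp_le_exp]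
      linarith
    · linarith
  refine ⟨_, linearIndependent_of_dotProduct hdual.1 hdual.2, fun i => ?_⟩
  fin_cases i
  · exact zb ha₂ hb₂ hv₂
  · exact zb ha₁ hb₁ hv₁
  · exact wb (by simp) (by simp) (by simp [hMdef])
  · exact wb (by simp) (by simp) (by simp [hMdef])

/-- No three independent simultaneous approximations to the powers of an extremal number are
better. -/
theorem IsExtremal.not_exists_approx_triple {ζ : ℝ} (hζ : IsExtremal ζ) {κ : ℝ} (hκ : 0 < κ)
    (hκ1 : κ ≤ 1) (y₀ : ℝ) :
    ∃ y, y₀ ≤ y ∧ ∀ v : Fin 3 → Fin 4 → ℤ, (∀ i, |(v i 0 : ℝ)| ≤ Real.exp y ∧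
      ∀ k : Fin 3, |ζ ^ ((k : ℕ) + 1) * v i 0 - v i k.succ|
        ≤ Real.exp (-((2 * Real.goldenRatio - 3 + κ) * y))) → ¬ LinearIndependent ℤ v := by
  obtain ⟨g1, g2⟩ := goldenRatio_bounds
  have hg := Real.goldenRatio_sq
  set g := Real.goldenRatio with hgdef
  obtain ⟨ε, hε, hεκ⟩ : ∃ ε : ℝ, 0 < ε ∧ 100 * ε = κ := ⟨κ / 100, by positivity, by ring⟩
  obtain ⟨s₁, hs₁⟩ := hζ.exists_pairs hε
  obtain ⟨t₂, ht₂⟩ := exists_le_exp_mul (10 * (1 + |ζ|)) hε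
  set σ := max (max (3 * |y₀|) s₁) (3 * t₂) with hσ
  have hsa : 3 * |y₀| ≤ σ := (le_max_left _ _).trans (le_max_left _ _)
  have hsb : s₁ ≤ σ := (le_max_right _ _).trans (le_max_left _ _)
  have hsd : 3 * t₂ ≤ σ := le_max_right _ _
  obtain ⟨t, P, Q, ht, hD, hP, hQ, hPv, hQv, l1, l2⟩ := hs₁ σ hsb
  have hεt : ε * t ≤ 1 / 100 * t := mul_le_mul_of_nonneg_right (by linarith) ht
  have hεt0 : 0 ≤ ε * t := by positivity
  have gt1 : 1.618 * t ≤ g * t := by gcongr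
  have gt2 : g * t ≤ 1.6181 * t := by gcongr
  have hσt : σ ≤ 3 * t := by linarith
  have hM := ht₂ t (by linarith)
  have hM1 : 1 ≤ 1 + |ζ| := by linarith [abs_nonneg ζ]
  set M := 1 + |ζ| with hMdef
  have hM2 : M * Real.exp (-(ε * t)) ≤ 1 / 10 := by
    rw [Real.exp_neg, ← div_eq_mul_inv, div_le_iff₀ (Real.exp_pos _)]; linarith
  set y := (2 * g + 1) * t - 3 * (ε * t) with hy
  have hyt : 4 * t ≤ y := by linarith
  refine ⟨y, by linarith [le_abs_self y₀], fun v hv => ?_⟩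
  have hε1 : Real.exp (-(ε * t)) ≤ M * Real.exp (-(ε * t)) :=
    le_mul_of_one_le_left (Real.exp_pos _).le hM1
  have orth : ∀ {a b : ℤ}, |(a : ℝ)| ≤ 1 → |(b : ℝ)| ≤ 1 → |a * ζ + b| ≤ M → ∀ i,
      v i ⬝ᵥ linMul a b P = 0 := by
    intro a b ha hb hab i
    have c0 : |cubEval ζ (linMul a b P)| ≤ M * Real.exp (-((2 * g + 1 - ε) * t)) := by
      rw [cubEval_linMul, abs_mul]
      exact mul_le_mul hab hPv (abs_nonneg _) (by linarith)
    have c3 := abs_dotProduct_le (abs_linMul_le ha hb hP) c0 (hv i).1 (hv i).2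
    rw [dotProduct_comm] at c3
    by_contra hne
    have c4 := one_le_abs_cast hne
    have m1 : Real.exp y * Real.exp (-((2 * g + 1 - ε) * t)) ≤ Real.exp (-(ε * t)) := by
      rw [← Real.exp_add, Real.exp_le_exp, hy]; linarith
    have m2 : Real.exp t * Real.exp (-((2 * g - 3 + κ) * y)) ≤ Real.exp (-(ε * t)) := by
      rw [← Real.exp_add, Real.exp_le_exp]
      have e1 : (2 * g - 3) * y = t - (2 * g - 3) * (3 * (ε * t)) := by
        rw [hy]; linear_combination 4 * t * hg
      have e2 : (2 * g - 3) * (3 * (ε * t)) ≤ 0.24 * (3 * (ε * t)) := by gcongr; linarith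
      have e3 : κ * y = 100 * (ε * y) := by rw [← hεκ]; ring
      have e4 := mul_le_mul_of_nonneg_left hyt hε.le
      linarith
    have m3 := mul_le_mul_of_nonneg_left m1 (by linarith : 0 ≤ M)
    linarith
  refine not_linearIndependent_of_dotProduct_eq_zero
    (orth (a := 0) (b := 1) (by simp) (by simp) (by simp [hMdef]))
    (orth (a := 1) (b := 0) (by simp) (by simp) (by simp [hMdef]))
    (u₁ := cof4 (linMul 0 1 Q) (linMul 1 0 Q) (linMul 1 0 P))
    (u₂ := cof4 (linMul 0 1 Q) (linMul 1 0 Q) (linMul 0 1 P)) ?_ ?_ ?_ ?_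
  · rw [dotProduct_comm, linMul_dotProduct_cof4]
    exact mul_ne_zero (by norm_num) hD
  · rw [dotProduct_comm]; exact dotProduct_cof4_self_right _ _ _
  · rw [dotProduct_comm]; exact dotProduct_cof4_self_right _ _ _
  · rw [dotProduct_comm, linMul_dotProduct_cof4]
    exact mul_ne_zero (by norm_num) hD

/-- The cubic integer polynomial with prescribed coefficients. -/
noncomputable def vecPoly : (Fin 4 → ℤ) →ₗ[ℤ] ℤ[X] :=
  ∑ i : Fin 4, (Polynomial.monomial (R := ℤ) (i : ℕ)) ∘ₗ LinearMap.proj i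

theorem vecPoly_apply (v : Fin 4 → ℤ) :
    vecPoly v = ∑ i : Fin 4, Polynomial.monomial (i : ℕ) (v i) := by
  simp [vecPoly]

theorem coeff_vecPoly (v : Fin 4 → ℤ) (i : Fin 4) : (vecPoly v).coeff i = v i := by
  rw [vecPoly_apply, Polynomial.finsetSum_coeff]
  simp [Polynomial.coeff_monomial, Fin.val_inj]

theorem natDegree_vecPoly_le (v : Fin 4 → ℤ) : (vecPoly v).natDegree ≤ 3 := by
  rw [vecPoly_apply]
  refine Polynomial.natDegree_sum_le_of_forall_le _ _ fun i _ => ?_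
  exact (Polynomial.natDegree_monomial_le _).trans (by omega)

theorem vecPoly_injective : Function.Injective vecPoly := fun v w h => by
  ext i
  rw [← coeff_vecPoly v, h, coeff_vecPoly]

theorem pev_vecPoly (ζ : ℝ) (v : Fin 4 → ℤ) : pev ζ (vecPoly v) = cubEval ζ v := by
  rw [pev, vecPoly_apply, map_sum]
  simp [Fin.sum_univ_four, Polynomial.aeval_monomial, cubEval]

theorem vecPoly_coeff {P : ℤ[X]} (hP : P.natDegree ≤ 3) :
    vecPoly (fun k => P.coeff k) = P := by
  ext n
  by_cases hn : n < 4
  · exact coeff_vecPoly _ ⟨n, hn⟩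
  · rw [Polynomial.coeff_eq_zero_of_natDegree_lt
        ((natDegree_vecPoly_le _).trans_lt (Nat.not_lt.1 hn)),
      Polynomial.coeff_eq_zero_of_natDegree_lt (hP.trans_lt (Nat.not_lt.1 hn))]

theorem polyH_vecPoly_le {v : Fin 4 → ℤ} {X : ℝ} (h : ∀ k, |(v k : ℝ)| ≤ X) :
    polyH (vecPoly v) ≤ X := by
  have hX : 0 ≤ X := (abs_nonneg _).trans (h 0)
  rw [polyH, ← Nat.le_floor_iff hX]
  refine Finset.sup_le fun i hi => ?_
  have hi4 : i < 4 := by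
    have := (Polynomial.le_natDegree_of_mem_supp i hi).trans (natDegree_vecPoly_le v)
    omega
  rw [Nat.le_floor_iff hX, show (vecPoly v).coeff i = v ⟨i, hi4⟩ from coeff_vecPoly v ⟨i, hi4⟩,
    Nat.cast_natAbs, Int.cast_abs]
  exact h _

theorem rpow_log_exp {X : ℝ} (hX : 0 < X) (η : ℝ) :
    X ^ (-η) = Real.exp (-(η * Real.log X)) := by
  rw [Real.rpow_def_of_pos hX]
  ring_nf

theorem whSetJ_anti (n : ℕ) {i j : ℕ} (hij : i ≤ j) (ζ : ℝ) : whSetJ n j ζ ⊆ whSetJ n i ζ := by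
  rintro η ⟨X₀, h⟩
  refine ⟨X₀, fun X hX => ?_⟩
  obtain ⟨P, hP, hP'⟩ := h X hX
  exact ⟨P ∘ Fin.castLE hij, hP.comp _ (Fin.castLE_injective hij), fun k => hP' _⟩

theorem lamhSetJ_anti (n : ℕ) {i j : ℕ} (hij : i ≤ j) (ζ : ℝ) :
    lamhSetJ n j ζ ⊆ lamhSetJ n i ζ := by
  rintro η ⟨X₀, h⟩
  refine ⟨X₀, fun X hX => ?_⟩
  obtain ⟨P, hP, hP'⟩ := h X hX
  exact ⟨P ∘ Fin.castLE hij, hP.comp _ (Fin.castLE_injective hij), fun k => hP' _⟩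

theorem IsExtremal.mem_whSetJ {ζ : ℝ} (hζ : IsExtremal ζ) {κ : ℝ} (hκ : 0 < κ) (hκ1 : κ ≤ 1) :
    2 * Real.goldenRatio - 1 - κ ∈ whSetJ 3 4 ζ := by
  obtain ⟨s₀, hs₀⟩ := hζ.exists_cubic_quadruple hκ hκ1
  refine ⟨Real.exp s₀, fun X hX => ?_⟩
  have hX0 : 0 < X := (Real.exp_pos _).trans_le hX
  obtain ⟨v, hv, hv'⟩ := hs₀ (Real.log X) ((Real.le_log_iff_exp_le hX0).2 hX)
  rw [Real.exp_log hX0] at hv'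
  refine ⟨vecPoly ∘ v, hv.map' _ (LinearMap.ker_eq_bot.2 vecPoly_injective), fun i =>
    ⟨natDegree_vecPoly_le _, polyH_vecPoly_le (hv' i).1, ?_, ?_⟩⟩
  · rw [abs_pos]
    refine Transcendental.aeval_int_ne_zero hζ.1 fun h => hv.ne_zero i (vecPoly_injective ?_)
    rwa [map_zero]
  · rw [Function.comp_apply, pev_vecPoly, rpow_log_exp hX0]
    exact (hv' i).2

theorem IsExtremal.le_of_mem_whSetJ {ζ : ℝ} (hζ : IsExtremal ζ) {η : ℝ}
    (hη : η ∈ whSetJ 3 3 ζ) : η ≤ 2 * Real.goldenRatio - 1 := by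
  by_contra! hlt
  obtain ⟨X₀, h⟩ := hη
  obtain ⟨s, hs, hs'⟩ := hζ.not_exists_cubic_triple (κ := min 1 (η - (2 * Real.goldenRatio - 1)))
    (lt_min one_pos (sub_pos.2 hlt)) (min_le_left _ _) (max 0 X₀)
  have hs0 : 0 ≤ s := (le_max_left _ _).trans hs
  obtain ⟨P, hP, hP'⟩ := h (Real.exp s) (by
    linarith [Real.add_one_le_exp s, le_max_right 0 X₀])
  have hvec : ∀ i, vecPoly (fun k => (P i).coeff k) = P i := fun i => vecPoly_coeff (hP' i).1
  refine hs' (fun i k => (P i).coeff k) (fun i => ⟨fun k =>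
    (abs_coeff_le_polyH _ _).trans (hP' i).2.1, ?_⟩) (.of_comp vecPoly ?_)
  · rw [← pev_vecPoly, hvec]
    refine (hP' i).2.2.2.trans ?_
    rw [rpow_log_exp (Real.exp_pos s), Real.log_exp, Real.exp_le_exp, neg_le_neg_iff]
    gcongr
    linarith [min_le_right 1 (η - (2 * Real.goldenRatio - 1))]
  · convert hP using 1
    exact funext hvec

theorem IsExtremal.mem_lamhSetJ {ζ : ℝ} (hζ : IsExtremal ζ) {κ : ℝ} (hκ : 0 < κ)
    (hκ1 : κ ≤ 1) : 2 * Real.goldenRatio - 3 - κ ∈ lamhSetJ 3 4 ζ := by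
  obtain ⟨s₀, hs₀⟩ := hζ.exists_approx_quadruple hκ hκ1
  refine ⟨Real.exp s₀, fun X hX => ?_⟩
  have hX0 : 0 < X := (Real.exp_pos _).trans_le hX
  obtain ⟨v, hv, hv'⟩ := hs₀ (Real.log X) ((Real.le_log_iff_exp_le hX0).2 hX)
  rw [Real.exp_log hX0] at hv'
  refine ⟨v, hv, fun i => ⟨?_, fun k => ?_⟩⟩
  · rw [Int.cast_abs]
    exact (hv' i).1
  · rw [rpow_log_exp hX0]
    exact (hv' i).2 k

theorem IsExtremal.le_of_mem_lamhSetJ {ζ : ℝ} (hζ : IsExtremal ζ) {η : ℝ}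
    (hη : η ∈ lamhSetJ 3 3 ζ) : η ≤ 2 * Real.goldenRatio - 3 := by
  by_contra! hlt
  obtain ⟨X₀, h⟩ := hη
  obtain ⟨s, hs, hs'⟩ := hζ.not_exists_approx_triple
    (κ := min 1 (η - (2 * Real.goldenRatio - 3)))
    (lt_min one_pos (sub_pos.2 hlt)) (min_le_left _ _) (max 0 X₀)
  have hs0 : 0 ≤ s := (le_max_left _ _).trans hs
  obtain ⟨v, hv, hv'⟩ := h (Real.exp s) (by
    linarith [Real.add_one_le_exp s, le_max_right 0 X₀])
  refine hs' v (fun i => ⟨?_, fun k => ((hv' i).2 k).trans ?_⟩) hv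
  · rw [← Int.cast_abs]
    exact (hv' i).1
  · rw [rpow_log_exp (Real.exp_pos s), Real.log_exp, Real.exp_le_exp, neg_le_neg_iff]
    gcongr
    linarith [min_le_right 1 (η - (2 * Real.goldenRatio - 3))]

/-- A real set bounded by `a` that contains points just below `a` has supremum `a`. -/
theorem csSup_eq_of_sub_mem {S : Set ℝ} {a : ℝ} (hle : ∀ x ∈ S, x ≤ a)
    (hmem : ∀ κ, 0 < κ → κ ≤ 1 → a - κ ∈ S) : sSup S = a := by
  refine csSup_eq_of_forall_le_of_forall_lt_exists_gt ⟨_, hmem 1 one_pos le_rfl⟩ hle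
    fun w hw => ⟨_, hmem (min 1 ((a - w) / 2)) ?_ (min_le_left _ _), ?_⟩
  · exact lt_min one_pos (by linarith)
  · linarith [min_le_right 1 ((a - w) / 2)]

theorem extremal_uniform_minima_34 (ζ : ℝ) (hζ : IsExtremal ζ) :
    whExpJ 3 3 ζ = Real.sqrt 5 ∧ whExpJ 3 4 ζ = Real.sqrt 5 ∧
    lamhExpJ 3 3 ζ = 1 / (2 + Real.sqrt 5) ∧ lamhExpJ 3 4 ζ = 1 / (2 + Real.sqrt 5) := by
  have e1 : Real.sqrt 5 = 2 * Real.goldenRatio - 1 := by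
    rw [Real.goldenRatio]
    ring
  have e2 : 1 / (2 + Real.sqrt 5) = 2 * Real.goldenRatio - 3 := by
    rw [div_eq_iff (by positivity), e1]
    linear_combination -4 * Real.goldenRatio_sq
  have hw := whSetJ_anti 3 (show 3 ≤ 4 by norm_num) ζ
  have hl := lamhSetJ_anti 3 (show 3 ≤ 4 by norm_num) ζ
  rw [e2, e1]
  exact ⟨csSup_eq_of_sub_mem (fun _ => hζ.le_of_mem_whSetJ) fun _ h h' => hw (hζ.mem_whSetJ h h'),
    csSup_eq_of_sub_mem (fun _ hx => hζ.le_of_mem_whSetJ (hw hx)) fun _ => hζ.mem_whSetJ,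
    csSup_eq_of_sub_mem (fun _ => hζ.le_of_mem_lamhSetJ)
      fun _ h h' => hl (hζ.mem_lamhSetJ h h'),
    csSup_eq_of_sub_mem (fun _ hx => hζ.le_of_mem_lamhSetJ (hl hx)) fun _ => hζ.mem_lamhSetJ⟩
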